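/- If G is a graph in obs(P1) that is not isomorphic to any of the 33 graphs in O, then G is triconnected. -/

import Mathlib

open SimpleGraph

/-- `H` is a minor of `G` (branch-set definition): there is a family of connected, nonempty,
pairwise disjoint branch sets in `G`, indexed by the vertices of `H`, such that vertices
adjacent in `H` have an edge of `G` between their branch sets. -/
def IsMinorOf {W V : Type} (H : SimpleGraph W) (G : SimpleGraph V) : Prop :=
  ∃ f : W → Set V,
    (∀ w, (G.induce (f w)).Connected) ∧
    (∀ ⦃w w' : W⦄, w ≠ w' → Disjoint (f w) (f w')) ∧
    (∀ ⦃w w' : W⦄, H.Adj w w' → ∃ a ∈ f w, ∃ b ∈ f w', G.Adj a b)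

/-- A pseudoforest: every connected component contains at most one cycle, i.e. any two
cycles lying in the same connected component have the same edge set. -/
def Pseudoforest {V : Type} (G : SimpleGraph V) : Prop :=
  ∀ ⦃u v : V⦄ (c : G.Walk u u) (c' : G.Walk v v),
    c.IsCycle → c'.IsCycle → G.Reachable u v → ∀ e, e ∈ c.edges ↔ e ∈ c'.edges

/-- An apex-pseudoforest: removing at most one vertex yields a pseudoforest. -/
def ApexPseudoforest {V : Type} (G : SimpleGraph V) : Prop :=
  ∃ s : Set V, s.Subsingleton ∧ Pseudoforest (G.induce sᶜ)

/-- `G` is a minor-obstruction for the class of apex-pseudoforests: `G` is not an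
apex-pseudoforest but every proper minor of `G` is. -/
def ObsApexPseudoforest {V : Type} (G : SimpleGraph V) : Prop :=
  ¬ ApexPseudoforest G ∧
    ∀ (W : Type) [Finite W] (H : SimpleGraph W),
      IsMinorOf H G → IsEmpty (H ≃g G) → ApexPseudoforest H

/-- `G` is `k`-connected: between any two distinct vertices `u ≠ v` there exist `k`
pairwise distinct `(u,v)`-paths, any two of which share no vertices other than `u,v`. -/
def KConnected {V : Type} (k : ℕ) (G : SimpleGraph V) : Prop :=
  ∀ ⦃u v : V⦄, u ≠ v → ∃ P : Fin k → G.Walk u v,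
    Function.Injective P ∧ (∀ i, (P i).IsPath) ∧
      ∀ i j, i ≠ j → ∀ x, x ∈ (P i).support → x ∈ (P j).support → x = u ∨ x = v

/-- The simple graph on `Fin n` with the given list of (0-indexed) edges. -/
def mkGraph (n : ℕ) (E : List (ℕ × ℕ)) : SimpleGraph (Fin n) :=
  SimpleGraph.fromRel fun a b => ((a : ℕ), (b : ℕ)) ∈ E

/-- Obstruction 1: two disjoint diamonds. -/
def O1 : SimpleGraph (Fin 8) :=
  mkGraph 8 [(0,1),(0,2),(0,3),(1,2),(1,3),(4,5),(4,6),(4,7),(5,6),(5,7)]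
/-- Obstruction 2: two disjoint butterflies. -/
def O2 : SimpleGraph (Fin 10) :=
  mkGraph 10 [(0,1),(0,2),(1,2),(0,3),(0,4),(3,4),(5,6),(5,7),(6,7),(5,8),(5,9),(8,9)]
/-- Obstruction 3: a diamond plus a butterfly. -/
def O3 : SimpleGraph (Fin 9) :=
  mkGraph 9 [(0,1),(0,2),(0,3),(1,2),(1,3),(4,5),(4,6),(5,6),(4,7),(4,8),(7,8)]
def O4 : SimpleGraph (Fin 8) :=
  mkGraph 8 [(0,1),(0,2),(1,2),(2,3),(2,4),(3,4),(3,5),(4,5),(5,6),(5,7),(6,7)]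
def O5 : SimpleGraph (Fin 8) :=
  mkGraph 8 [(0,1),(0,2),(1,2),(2,3),(2,4),(3,4),(3,5),(4,6),(5,6),(5,7),(6,7)]
def O6 : SimpleGraph (Fin 8) :=
  mkGraph 8 [(0,1),(0,2),(1,2),(2,3),(2,4),(3,4),(3,5),(4,5),(3,6),(5,6),(4,7),(5,7)]
def O7 : SimpleGraph (Fin 7) :=
  mkGraph 7 [(0,1),(0,6),(1,6),(2,3),(2,4),(2,5),(3,4),(3,5),(4,6),(5,6)]
def O8 : SimpleGraph (Fin 7) :=
  mkGraph 7 [(0,1),(0,2),(1,2),(2,3),(2,4),(2,5),(3,4),(3,5),(4,5),(4,6),(5,6)]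
def O9 : SimpleGraph (Fin 9) :=
  mkGraph 9 [(0,1),(0,2),(1,2),(2,3),(2,4),(3,4),(3,5),(4,5),(2,6),(4,6),(2,7),(3,7),(3,8),(4,8)]
def O10 : SimpleGraph (Fin 9) :=
  mkGraph 9 [(0,1),(1,2),(2,3),(3,0),(0,4),(1,4),(1,5),(2,5),(2,6),(3,6),(0,7),(0,8),(7,8)]
def O11 : SimpleGraph (Fin 9) :=
  mkGraph 9 [(0,1),(0,2),(1,2),(3,4),(3,5),(4,5),(6,7),(6,8),(7,8),(2,3),(1,8),(4,8)]
def O12 : SimpleGraph (Fin 9) :=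
  mkGraph 9 [(0,1),(0,2),(1,2),(3,4),(3,5),(4,5),(6,7),(6,8),(7,8),(2,3),(2,7),(3,6)]
def O13 : SimpleGraph (Fin 9) :=
  mkGraph 9 [(0,1),(0,2),(1,2),(3,4),(3,5),(4,5),(6,7),(6,8),(7,8),(2,3),(2,8),(3,8)]
def O14 : SimpleGraph (Fin 8) :=
  mkGraph 8 [(0,1),(0,2),(1,2),(1,4),(2,3),(2,4),(3,4),(3,5),(4,5),(1,6),(1,7),(6,7)]
def O15 : SimpleGraph (Fin 9) :=
  mkGraph 9 [(0,1),(0,2),(1,2),(2,3),(2,4),(3,4),(4,5),(4,6),(5,6),(6,7),(6,8),(7,8),(2,6)]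
def O16 : SimpleGraph (Fin 6) :=
  mkGraph 6 [(0,2),(0,3),(0,4),(0,5),(1,2),(1,3),(1,4),(1,5),(2,3),(4,5)]
def O17 : SimpleGraph (Fin 6) :=
  mkGraph 6 [(0,1),(1,3),(3,2),(2,0),(4,0),(4,1),(4,2),(4,3),(5,0),(5,1)]
def O18 : SimpleGraph (Fin 8) :=
  mkGraph 8 [(0,1),(1,2),(2,3),(3,0),(4,0),(4,1),(5,1),(5,2),(6,2),(6,3),(7,3),(7,0)]
def O19 : SimpleGraph (Fin 7) :=
  mkGraph 7 [(0,2),(0,3),(1,2),(1,3),(2,3),(0,4),(4,1),(5,0),(5,4),(6,4),(6,1)]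
def O20 : SimpleGraph (Fin 6) :=
  mkGraph 6 [(1,2),(1,4),(1,5),(2,4),(2,5),(4,5),(0,1),(0,4),(2,3),(3,5)]
def O21 : SimpleGraph (Fin 7) :=
  mkGraph 7 [(0,1),(0,3),(0,4),(1,3),(1,4),(3,5),(4,5),(1,2),(2,4),(3,6),(5,6)]
def O22 : SimpleGraph (Fin 8) :=
  mkGraph 8 [(0,1),(0,3),(1,4),(3,4),(1,2),(2,4),(7,0),(7,3),(5,7),(5,0),(6,7),(6,3)]
def O23 : SimpleGraph (Fin 7) :=
  mkGraph 7 [(2,3),(2,4),(2,6),(3,4),(3,6),(4,6),(5,3),(5,4),(0,2),(0,3),(1,2),(1,4)]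
def O24 : SimpleGraph (Fin 7) :=
  mkGraph 7 [(0,1),(0,2),(1,2),(1,3),(2,4),(3,5),(3,6),(4,5),(4,6),(5,6)]
def O25 : SimpleGraph (Fin 8) :=
  mkGraph 8 [(0,1),(0,3),(1,3),(1,2),(1,5),(2,5),(1,7),(2,7),(3,4),(4,5),(3,5),(3,6),(5,6)]
def O26 : SimpleGraph (Fin 9) :=
  mkGraph 9 [(2,3),(2,4),(3,4),(5,3),(5,4),(8,3),(8,4),(0,2),(0,3),(7,2),(7,3),(1,2),(1,4),(6,2),(6,4)]
def O27 : SimpleGraph (Fin 8) :=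
  mkGraph 8 [(0,2),(1,2),(0,3),(2,3),(1,6),(2,6),(3,4),(6,7),(4,5),(5,7),(3,7),(4,7)]
def O28 : SimpleGraph (Fin 7) :=
  mkGraph 7 [(0,1),(0,2),(1,2),(1,3),(1,5),(3,5),(3,4),(3,6),(4,6),(2,5),(5,6)]
def O29 : SimpleGraph (Fin 9) :=
  mkGraph 9 [(0,1),(0,2),(1,2),(3,4),(3,5),(4,5),(6,7),(6,8),(7,8),(2,3),(1,7),(4,6)]
def O30 : SimpleGraph (Fin 8) :=
  mkGraph 8 [(0,1),(0,2),(1,2),(3,4),(3,5),(4,5),(6,7),(1,6),(4,6),(0,7),(5,7)]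
/-- Obstruction 31: the prism. -/
def O31 : SimpleGraph (Fin 6) :=
  mkGraph 6 [(0,1),(0,2),(1,2),(3,4),(3,5),(4,5),(0,3),(1,4),(2,5)]
/-- Obstruction 32: `K₃,₃`. -/
def O32 : SimpleGraph (Fin 6) :=
  mkGraph 6 [(0,3),(0,4),(0,5),(1,3),(1,4),(1,5),(2,3),(2,4),(2,5)]
/-- Obstruction 33: `K₅` minus one edge. -/
def O33 : SimpleGraph (Fin 5) :=
  mkGraph 5 [(0,1),(0,2),(0,3),(0,4),(1,2),(1,3),(1,4),(2,3),(2,4)]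

/-- The list `O` of the 33 obstructions. -/
def OList : List ((n : ℕ) × SimpleGraph (Fin n)) :=
  [⟨8, O1⟩, ⟨10, O2⟩, ⟨9, O3⟩, ⟨8, O4⟩, ⟨8, O5⟩, ⟨8, O6⟩, ⟨7, O7⟩, ⟨7, O8⟩, ⟨9, O9⟩,
   ⟨9, O10⟩, ⟨9, O11⟩, ⟨9, O12⟩, ⟨9, O13⟩, ⟨8, O14⟩, ⟨9, O15⟩, ⟨6, O16⟩, ⟨6, O17⟩,
   ⟨8, O18⟩, ⟨7, O19⟩, ⟨6, O20⟩, ⟨7, O21⟩, ⟨8, O22⟩, ⟨7, O23⟩, ⟨7, O24⟩, ⟨8, O25⟩,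
   ⟨9, O26⟩, ⟨8, O27⟩, ⟨7, O28⟩, ⟨9, O29⟩, ⟨8, O30⟩, ⟨6, O31⟩, ⟨6, O32⟩, ⟨5, O33⟩]

/-- `G` is isomorphic to one of the 33 graphs in `O`. -/
def InO {V : Type} (G : SimpleGraph V) : Prop :=
  ∃ H ∈ OList, Nonempty (G ≃g H.2)

namespace CoreSearch

open Finset

/-- Evaluate `f n` after normalising `n` to a numeral (this only matters for kernel reduction). -/
def force {α : Type} (n : ℕ) (f : ℕ → α) : α := n.rec (f 0) fun m _ => f m.succ

@[simp] lemma force_eq {α : Type} (n : ℕ) (f : ℕ → α) : force n f = f n := by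
  cases n <;> rfl

lemma beq_eq_decide (a b : ℕ) : Nat.beq a b = decide (a = b) := by
  rw [Bool.eq_iff_iff]; simp [Nat.beq_eq]

lemma ble_eq_decide (a b : ℕ) : Nat.ble a b = decide (a ≤ b) := by
  rw [Bool.eq_iff_iff]; simp [Nat.ble_eq]

/-! ### Packing functions on the subsets of `range k` into a single number -/

/-- The width of a packed function on the subsets of `range k`, eight bits per subset. -/
def shift (k : ℕ) : ℕ := Nat.pow 2 (8 * Nat.pow 2 k)

/-- The values of `g` on the subsets of `range k`, in base `256`. -/
def pack : ℕ → (Finset ℕ → ℕ) → ℕ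
  | 0, g => g ∅
  | k + 1, g => pack k (fun S => g (insert k S)) + shift k * pack k g

def ones : ℕ → ℕ
  | 0 => 1
  | k + 1 => ones k + shift k * ones k

def mask (v : ℕ) : ℕ → ℕ
  | 0 => 128
  | k + 1 => (bif Nat.beq v k then 0 else mask v k) + shift k * mask v k

/-- Given that `X` packs `S ↦ H S + (k - #S)` and `m` packs `128` times an indicator, test
whether some indicated set satisfies `#S + s < H S`. -/
def dense (X k s m : ℕ) : Bool := !Nat.beq (Nat.land (X + (127 - k - s) * ones k) m) 0

lemma shift_succ (k : ℕ) : shift (k + 1) = shift k * shift k := by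
  simp only [shift, Nat.pow_eq]
  rw [← pow_add]; congr 1; rw [pow_succ]; ring

lemma shift_pos (k : ℕ) : 0 < shift k := by simp [shift]

lemma subset_range_succ {k : ℕ} {S : Finset ℕ} (h : S ⊆ range k) : S ⊆ range (k + 1) :=
  h.trans (range_subset_range.2 k.le_succ)

lemma insert_subset_range_succ {k : ℕ} {S : Finset ℕ} (h : S ⊆ range k) :
    insert k S ⊆ range (k + 1) :=
  insert_subset (by simp) (subset_range_succ h)

lemma notMem_of_subset_range {k : ℕ} {S : Finset ℕ} (h : S ⊆ range k) : k ∉ S :=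
  fun hk => by simpa using h hk

lemma forall_subset_range_succ {k : ℕ} {p : Finset ℕ → Prop} :
    (∀ S ⊆ range (k + 1), p S) ↔ (∀ S ⊆ range k, p (insert k S)) ∧ ∀ S ⊆ range k, p S := by
  refine ⟨fun h => ⟨fun S hS => h _ (insert_subset_range_succ hS),
    fun S hS => h _ (subset_range_succ hS)⟩, fun h S hS => ?_⟩
  by_cases hk : k ∈ S
  · rw [← insert_erase hk]
    refine h.1 _ fun x hx => ?_
    have := hS (mem_of_mem_erase hx)
    have := ne_of_mem_erase hx
    simp at *; omega
  · refine h.2 _ fun x hx => ?_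
    have := hS hx
    have : x ≠ k := fun h => hk (h ▸ hx)
    simp at *; omega

lemma pack_congr {k : ℕ} {g h : Finset ℕ → ℕ} (H : ∀ S ⊆ range k, g S = h S) :
    pack k g = pack k h := by
  induction k generalizing g h with
  | zero => exact H _ (by simp)
  | succ k ih =>
    rw [forall_subset_range_succ] at H
    simp only [pack]
    rw [ih H.1, ih H.2]

lemma pack_add (k : ℕ) (g h : Finset ℕ → ℕ) :
    pack k (fun S => g S + h S) = pack k g + pack k h := by
  induction k generalizing g h with
  | zero => rfl
  | succ k ih => simp only [pack, ih]; ring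

lemma pack_const (k a : ℕ) : pack k (fun _ => a) = a * ones k := by
  induction k with
  | zero => simp [pack, ones]
  | succ k ih => simp only [pack, ones, ih]; ring

lemma mask_eq (v k : ℕ) : mask v k = pack k fun S => if v ∉ S then 128 else 0 := by
  induction k with
  | zero => simp [mask, pack]
  | succ k ih =>
    simp only [mask, pack, ih]
    congr 1
    by_cases h : v = k
    · subst h; simp [pack_const]
    · have : Nat.beq v k = false := by simp [beq_eq_decide, h]
      rw [this]; simp [h]

lemma pack_lt {k : ℕ} {g : Finset ℕ → ℕ} (H : ∀ S ⊆ range k, g S < 256) :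
    pack k g < shift k := by
  induction k generalizing g with
  | zero => simpa [shift, pack] using H ∅ (by simp)
  | succ k ih =>
    rw [forall_subset_range_succ] at H
    have h1 := ih H.1
    have h2 := ih H.2
    rw [shift_succ]
    simp only [pack]
    nlinarith

lemma land_add_mul {n a b c d : ℕ} (ha : a < 2 ^ n) (hc : c < 2 ^ n) :
    (a + 2 ^ n * b) &&& (c + 2 ^ n * d) = (a &&& c) + 2 ^ n * (b &&& d) := by
  have hac : a &&& c < 2 ^ n := Nat.and_lt_two_pow _ hc
  refine Nat.eq_of_testBit_eq fun i => ?_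
  rw [Nat.testBit_and, add_comm a, add_comm c, add_comm (a &&& c),
    Nat.testBit_two_pow_mul_add _ ha, Nat.testBit_two_pow_mul_add _ hc,
    Nat.testBit_two_pow_mul_add _ hac]
  split_ifs <;> simp

lemma pack_land {k : ℕ} {g h : Finset ℕ → ℕ} (hg : ∀ S ⊆ range k, g S < 256)
    (hh : ∀ S ⊆ range k, h S < 256) :
    Nat.land (pack k g) (pack k h) = pack k fun S => g S &&& h S := by
  induction k generalizing g h with
  | zero => rfl
  | succ k ih =>
    rw [forall_subset_range_succ] at hg hh
    have h1 := pack_lt hg.1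
    have h2 := pack_lt hh.1
    simp only [pack]
    rw [← ih hg.1 hh.1, ← ih hg.2 hh.2]
    simp only [shift, Nat.pow_eq] at *
    exact land_add_mul h1 h2

lemma pack_eq_zero {k : ℕ} {g : Finset ℕ → ℕ} : pack k g = 0 ↔ ∀ S ⊆ range k, g S = 0 := by
  induction k generalizing g with
  | zero => simp [pack]
  | succ k ih =>
    rw [forall_subset_range_succ, ← ih, ← ih]
    simp [pack, (shift_pos k).ne']

lemma land_mask (x y k : ℕ) :
    Nat.land (mask x k) (mask y k) = pack k fun S => if x ∉ S ∧ y ∉ S then 128 else 0 := by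
  rw [mask_eq, mask_eq, pack_land (by intros; split_ifs <;> simp) (by intros; split_ifs <;> simp)]
  refine pack_congr fun S _ => ?_
  by_cases h : x ∈ S <;> by_cases h' : y ∈ S <;> simp [h, h']

set_option maxRecDepth 4000 in
lemma land_128 : ∀ x < 256, x &&& 128 = 0 ↔ x < 128 := by decide

lemma dense_iff {k s : ℕ} {H : Finset ℕ → ℕ} {P : Finset ℕ → Prop} [DecidablePred P]
    (hk : k + s ≤ 127) (hH : ∀ S ⊆ range k, H S + k ≤ 128) :
    dense (pack k fun S => H S + (k - #S)) k s (pack k fun S => if P S then 128 else 0) = true ↔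
      ∃ S ⊆ range k, P S ∧ #S + s < H S := by
  unfold dense
  have hlt : ∀ S ⊆ range k, H S + (k - #S) + (127 - k - s) < 256 := fun S hS => by
    have := hH S hS; omega
  rw [← pack_const, ← pack_add, pack_land hlt (by intros; split_ifs <;> simp)]
  rw [beq_eq_decide, Bool.not_eq_true', decide_eq_false_iff_not, pack_eq_zero]
  push Not
  refine exists_congr fun S => and_congr_right fun hS => ?_
  have hc : #S ≤ k := by simpa using card_le_card hS
  have := land_128 _ (hlt S hS)
  have h0 := hH S hS
  by_cases hP : P S
  · simp only [hP, if_true, true_and, ne_eq, this]; omega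
  · simp [hP]

/-- The `j`-th entry of a vector of length `n` with entries below `64`, stored as a number. -/
def digit (R n j : ℕ) : ℕ := R / Nat.pow 64 (n - 1 - j) % 64

def code (a : ℕ → ℕ) : ℕ → ℕ
  | 0 => 0
  | k + 1 => 64 * code a k + a k

lemma code_add (a b : ℕ → ℕ) (k : ℕ) : code a k + code b k = code (fun i => a i + b i) k := by
  induction k with
  | zero => rfl
  | succ k ih => simp only [code, ← ih]; ring

lemma code_congr {a b : ℕ → ℕ} {k : ℕ} (h : ∀ i < k, a i = b i) : code a k = code b k := by
  induction k with
  | zero => rfl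
  | succ k ih => simp only [code, ih fun i hi => h i (by omega), h k (by omega)]

lemma digit_code {a : ℕ → ℕ} {k j : ℕ} (hj : j < k) (ha : ∀ i < k, a i < 64) :
    digit (code a k) k j = a j := by
  induction k with
  | zero => omega
  | succ k ih =>
    rcases Nat.lt_succ_iff_lt_or_eq.1 hj with hjk | rfl
    · have h1 : k + 1 - 1 - j = (k - 1 - j) + 1 := by omega
      rw [← ih hjk fun i hi => ha i (by omega)]
      simp only [digit, h1, code, Nat.pow_eq, pow_succ']
      rw [← Nat.div_div_eq_div_mul]
      congr 2
      have := ha k (by omega)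
      omega
    · have := ha j (by omega)
      simp [digit, code]; omega

/-- The entry `(i, j)` of the symmetric matrix of size `k` whose rows, in reverse order, are
given by their diagonal entries and the encoding of the entries left of the diagonal. -/
def entry : List (ℕ × ℕ) → ℕ → ℕ → ℕ → ℕ
  | [], _, _, _ => 0
  | r :: rs, k, i, j =>
    bif Nat.beq i k.pred then (bif Nat.beq j k.pred then r.1 else digit r.2 k.pred j)
    else (bif Nat.beq j k.pred then digit r.2 k.pred i else entry rs k.pred i j)

def rowsOf (w : ℕ → ℕ → ℕ) : ℕ → List (ℕ × ℕ)
  | 0 => []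
  | k + 1 => (w k k, code (w k) k) :: rowsOf w k

lemma entry_rowsOf {w : ℕ → ℕ → ℕ} {k i j : ℕ} (hs : ∀ i j, w i j = w j i)
    (hw : ∀ i < k, ∀ j < i, w i j < 64) (hi : i < k) (hj : j < k) :
    entry (rowsOf w k) k i j = w i j := by
  induction k with
  | zero => omega
  | succ k ih =>
    have hd : ∀ l < k, digit (code (w k) k) k l = w k l := fun l hl =>
      digit_code hl fun i hi => hw k (by omega) i hi
    simp only [rowsOf, entry, Nat.pred_succ, beq_eq_decide]
    rcases Nat.lt_succ_iff_lt_or_eq.1 hi with hik | rfl <;>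
    rcases Nat.lt_succ_iff_lt_or_eq.1 hj with hjk | rfl
    · simp [hik.ne, hjk.ne, ih (fun i hi => hw i (by omega)) hik hjk]
    · simp [hik.ne, hd i hik, hs i j]
    · simp [hjk.ne, hd j hjk]
    · simp

/-- The entry at position `j` from the end. -/
def look : List ℕ → ℕ → ℕ
  | [], _ => 0
  | a :: as, j => bif Nat.beq j as.length then a else look as j

/-- The embeddings of a weight matrix, given by its rows in reverse order, as a full principal
submatrix. -/
def embs (rows : List (ℕ × ℕ)) (k : ℕ) : List (ℕ × List ℕ) → List (List ℕ)
  | [] => [[]]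
  | r :: rs => (embs rows k rs).flatMap fun σ => (List.range k).flatMap fun i =>
      bif !(σ.any (Nat.beq i)) && Nat.beq r.1 (entry rows k i i) &&
        ((List.range rs.length).all fun j => Nat.beq (look r.2 j) (entry rows k i (look σ j)))
      then [i :: σ] else []

def nonApex (X k : ℕ) : Bool := (List.range k).all fun v => dense X k 0 (mask v k)

def delBad (rows : List (ℕ × ℕ)) (X k x y : ℕ) : Bool :=
  Nat.ble 1 (entry rows k x y) &&
  (List.range k).all fun v =>
    dense X k 1 (mask v k) || dense X k 0 (Nat.land (mask v k) (mask x k)) ||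
      dense X k 0 (Nat.land (mask v k) (mask y k))

def conBad (rows : List (ℕ × ℕ)) (X k x y : ℕ) : Bool :=
  !Nat.beq x y && Nat.beq (entry rows k x y) 1 &&
  ((List.range k).all fun z => Nat.beq z x || Nat.beq z y ||
     Nat.beq (entry rows k x z) 0 || Nat.beq (entry rows k y z) 0) &&
  dense X k 0 (Nat.land (mask x k) (mask y k))

def leaf (tbl : List (List (ℕ × List ℕ))) (rows : List (ℕ × ℕ)) (X k : ℕ) : Bool :=
  !nonApex X k ||
  ((List.range k).any fun x => (List.range x.succ).any fun y =>
     delBad rows X k x y || conBad rows X k x y) ||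
  tbl.any fun M => Nat.beq M.length k && !(embs rows k M).isEmpty

def all3 (f : ℕ → Bool) : Bool := f 0 && (f 1 && f 2)

def all4 (f : ℕ → Bool) : Bool := f 0 && (f 1 && (f 2 && f 3))

/-- Enumerate the entries `j, …, j + m - 1` of the row of a new vertex `k`, where `D` encodes the
current degrees, `A` packs the sums of the row over subsets, `R` encodes the row, `d` is the degree
of the new vertex, and `b` is the remaining budget. -/
def gen (D k lo : ℕ) (f : ℕ → ℕ → ℕ → ℕ → Bool) : ℕ → ℕ → ℕ → ℕ → ℕ → ℕ → Bool
  | 0, _, A, R, d, b => f A R d b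
  | m + 1, j, A, R, d, b => force (digit D k j) fun e => all4 fun a =>
      !(Nat.ble lo (e + a) && Nat.ble (2 * a + (3 - (e + a)) - (3 - e)) b) ||
        force (b - (2 * a + (3 - (e + a)) - (3 - e))) fun b =>
          gen D k lo f m j.succ (A + a * ones j + shift j * A) (64 * R + a) (d + a) b

/-- Extend a weight matrix of size `k` by `n` further vertices in all admissible ways, and test
whether every result contains a matrix of the table. -/
def search (tbl : List (List (ℕ × List ℕ))) :
    ℕ → ℕ → List (ℕ × ℕ) → ℕ → ℕ → ℕ → ℕ → Bool
  | 0, k, rows, X, _, _, _ => leaf tbl rows X k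
  | n + 1, k, rows, X, D, s, key =>
    force (bif Nat.beq n 0 then 3 else 0) fun lo =>
    all4 fun a => !(Nat.ble lo (digit D k 0 + a) && Nat.ble (16 * a) key) ||
    all4 fun a' => !(Nat.ble lo (digit D k 1 + a') && Nat.ble (a + a') (s + 3)) ||
    all3 fun t => !(Nat.ble (16 * a + 4 * a' + t) key && Nat.ble (a + a' + 2 * t) (s + 3)) ||
      gen D k lo (fun A R d b => force d fun d => force R fun R =>
        !(Nat.ble (3 - d) b && Nat.ble lo d) ||
        force (X + A + t * ones k + shift k * (X + ones k)) fun X =>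
        dense X k.succ 1 (mask 0 k.succ) || dense X k.succ 1 (mask 1 k.succ) ||
        (Nat.ble 1 n && nonApex X k.succ) ||
        force (64 * (D + R) + d) fun D => force (b - (3 - d)) fun s =>
          search tbl n k.succ ((t, R) :: rows) X D s (16 * a + 4 * a' + t))
        (k - 2) 2 (a + a' + a' * 256 + a * 65536) (64 * a + a') (a + a' + 2 * t)
        (s + 3 - (a + a' + 2 * t))

def start (tbl : List (List (ℕ × List ℕ))) (c : ℕ) : Bool :=
  [0, 1, 2].all fun t => [0, 1, 2].all fun t' => [0, 1, 2, 3].all fun a =>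
    !(Nat.ble t' t && Nat.ble (t + t') (6 - c)) ||
    search tbl (c - 2) 2 [(t', a), (t, 0)]
      (t + t' + a + (t' + 1) * 256 + (t + 1) * 65536 + 2 * 16777216)
      (64 * (a + 2 * t) + (a + 2 * t')) (6 - c - t - t') 1000

/-! ### The meaning of the search -/

/-- The number of edges of the weighted graph `w` inside `S`; `w i i` counts loops. -/
def val (w : ℕ → ℕ → ℕ) (S : Finset ℕ) : ℕ := ∑ i ∈ S, (w i i + ∑ j ∈ S with j < i, w i j)

/-- The degree of `j` in the weighted graph `w` restricted to `range k`. -/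
def degK (w : ℕ → ℕ → ℕ) (k j : ℕ) : ℕ := ∑ i ∈ range k, w j i + w j j

def keyOf (w : ℕ → ℕ → ℕ) (k : ℕ) : ℕ := 16 * w k 0 + 4 * w k 1 + w k k

def need (w : ℕ → ℕ → ℕ) (k : ℕ) : ℕ := w 0 0 + w 1 1 + ∑ j ∈ Ico 2 k, max 3 (degK w k j)

/-- The weighted graphs which arise as cores of obstructions. -/
structure Adm (w : ℕ → ℕ → ℕ) (c : ℕ) : Prop where
  two_le : 2 ≤ c
  le_six : c ≤ 6
  symm : ∀ i j, w i j = w j i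
  le_three : ∀ i j, w i j ≤ 3
  diag_le : ∀ i, w i i ≤ 2
  good0 : ∀ S ⊆ range c, 0 ∉ S → val w S ≤ #S + 1
  good1 : ∀ S ⊆ range c, 1 ∉ S → val w S ≤ #S + 1
  nonapex : ∀ v, ∃ S ⊆ range c, v ∉ S ∧ #S < val w S
  del : ∀ x < c, ∀ y < c, 1 ≤ w x y → ∃ v < c, ∀ S ⊆ range c, v ∉ S →
    val w S ≤ #S + if x ∈ S ∧ y ∈ S then 1 else 0
  con : ∀ x < c, ∀ y < c, x ≠ y → w x y = 1 →
    (∀ z < c, z ≠ x → z ≠ y → w x z = 0 ∨ w y z = 0) →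
    ∀ S ⊆ range c, x ∉ S → y ∉ S → val w S ≤ #S
  deg : ∀ x < c, 3 ≤ degK w c x
  budget : ∑ j ∈ Ico 2 c, degK w c j + w 0 0 + w 1 1 ≤ 2 * c
  diag_anti : w 1 1 ≤ w 0 0
  key_anti : ∀ i, 2 ≤ i → i + 1 < c → keyOf w (i + 1) ≤ keyOf w i

lemma val_insert (w : ℕ → ℕ → ℕ) {k : ℕ} {S : Finset ℕ} (h : S ⊆ range k) :
    val w (insert k S) = val w S + w k k + ∑ j ∈ S, w k j := by
  have hk := notMem_of_subset_range h
  have hlt : ∀ j ∈ S, j < k := fun j hj => mem_range.1 (h hj)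
  unfold val
  rw [sum_insert hk, filter_insert, if_neg (lt_irrefl _), filter_true_of_mem hlt]
  have : ∀ i ∈ S, w i i + ∑ j ∈ insert k S with j < i, w i j
      = w i i + ∑ j ∈ S with j < i, w i j := fun i hi => by
    rw [filter_insert, if_neg (hlt i hi).not_gt]
  rw [sum_congr rfl this]
  ring

lemma degK_succ (w : ℕ → ℕ → ℕ) (k j : ℕ) : degK w (k + 1) j = degK w k j + w j k := by
  simp only [degK, sum_range_succ]; ring

lemma need_succ (w : ℕ → ℕ → ℕ) {k : ℕ} (hk : 2 ≤ k) (hs : ∀ i j, w i j = w j i) :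
    need w (k + 1) = w 0 0 + w 1 1 + ∑ j ∈ Ico 2 k, max 3 (degK w k j + w k j) +
      max 3 (degK w k k + w k k) := by
  simp only [need, sum_Ico_succ_top hk, degK_succ, hs _ k]; ring

lemma need_le (w : ℕ → ℕ → ℕ) {k n : ℕ} (hk : 2 ≤ k) (hs : ∀ i j, w i j = w j i) :
    need w k + 3 * n ≤ need w (k + n) := by
  induction n with
  | zero => simp
  | succ n ih =>
    rw [← add_assoc, need_succ w (by omega) hs]
    have h1 : ∑ j ∈ Ico 2 (k + n), max 3 (degK w (k + n) j) ≤
        ∑ j ∈ Ico 2 (k + n), max 3 (degK w (k + n) j + w (k + n) j) :=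
      sum_le_sum fun j _ => by omega
    unfold need at ih ⊢
    omega

/-- The packed edge counts of `w` on the subsets of `range k`. -/
def packVal (w : ℕ → ℕ → ℕ) (k : ℕ) : ℕ := pack k fun S => val w S + (k - #S)

lemma packVal_succ (w : ℕ → ℕ → ℕ) (k : ℕ) :
    packVal w (k + 1) = packVal w k + pack k (fun S => ∑ i ∈ S, w k i) + w k k * ones k +
      shift k * (packVal w k + ones k) := by
  have h1 : ones k = pack k fun _ => 1 := by rw [pack_const, one_mul]
  unfold packVal
  rw [← pack_const, ← pack_add, ← pack_add, h1, ← pack_add]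
  simp only [pack]
  congr 1
  · refine pack_congr fun S hS => ?_
    rw [val_insert w hS, card_insert_of_notMem (notMem_of_subset_range hS)]
    omega
  · congr 1
    refine pack_congr fun S hS => ?_
    have hc : #S ≤ k := by simpa using card_le_card hS
    omega

lemma all3_iff {f : ℕ → Bool} : all3 f = true ↔ ∀ a ≤ 2, f a = true := by
  simp only [all3, Bool.and_eq_true]
  refine ⟨fun h a ha => ?_, fun h => ⟨h _ (by omega), h _ (by omega), h _ (by omega)⟩⟩
  interval_cases a <;> tauto

lemma all4_iff {f : ℕ → Bool} : all4 f = true ↔ ∀ a ≤ 3, f a = true := by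
  simp only [all4, Bool.and_eq_true]
  refine ⟨fun h a ha => ?_, fun h => ⟨h _ (by omega), h _ (by omega), h _ (by omega), h _ (by omega)⟩⟩
  interval_cases a <;> tauto

/-- The budget used by an entry `a` of a new row, when the current degree is `e`. -/
def cost (e a : ℕ) : ℕ := 2 * a + (3 - (e + a)) - (3 - e)

lemma gen_spec {D k lo : ℕ} {f : ℕ → ℕ → ℕ → ℕ → Bool} {a e : ℕ → ℕ}
    (ha : ∀ i, a i ≤ 3) (he : ∀ i < k, digit D k i = e i) (hlo : ∀ i < k, lo ≤ e i + a i)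
    {m j d b : ℕ} (hk : j + m = k) (hb : ∑ i ∈ Ico j k, cost (e i) (a i) ≤ b)
    (h : gen D k lo f m j (pack j fun S => ∑ i ∈ S, a i) (code a j) d b = true) :
    f (pack k fun S => ∑ i ∈ S, a i) (code a k) (d + ∑ i ∈ Ico j k, a i)
      (b - ∑ i ∈ Ico j k, cost (e i) (a i)) = true := by
  induction m generalizing j d b with
  | zero =>
    obtain rfl : j = k := by omega
    simpa [gen] using h
  | succ m ih =>
    have hjk : j < k := by omega
    rw [sum_eq_sum_Ico_succ_bot hjk] at hb ⊢
    rw [sum_eq_sum_Ico_succ_bot hjk]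
    simp only [gen, force_eq] at h
    rw [all4_iff] at h
    have h := h (a j) (ha j)
    rw [he j hjk] at h
    have hA : pack (j + 1) (fun S => ∑ i ∈ S, a i) = (pack j fun S => ∑ i ∈ S, a i) +
        a j * ones j + shift j * pack j fun S => ∑ i ∈ S, a i := by
      rw [← pack_const, ← pack_add]
      simp only [pack]
      congr 1
      refine pack_congr fun S hS => ?_
      rw [sum_insert (notMem_of_subset_range hS)]
      ring
    change (!(Nat.ble lo (e j + a j) && Nat.ble (cost (e j) (a j)) b) || _) = true at h
    rw [ble_eq_decide, ble_eq_decide, decide_eq_true (hlo j hjk),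
      decide_eq_true (show cost (e j) (a j) ≤ b by omega)] at h
    rw [← hA] at h
    have := ih (j := j + 1) (d := d + a j) (b := b - cost (e j) (a j)) (by omega) (by omega) h
    rw [← add_assoc, Nat.sub_add_eq]
    exact this

namespace Adm

variable {w : ℕ → ℕ → ℕ} {c : ℕ}

lemma degK_lt (h : Adm w c) {k : ℕ} (hk : k ≤ c) (j : ℕ) : degK w k j < 64 := by
  have h1 : ∑ i ∈ range k, w j i ≤ #(range k) • 3 := sum_le_card_nsmul _ _ _ fun i _ => h.le_three j i
  have h2 := h.diag_le j
  have h3 := h.le_six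
  simp only [card_range, smul_eq_mul] at h1
  unfold degK
  omega

lemma val_add_le (h : Adm w c) {k : ℕ} (hk : k ≤ c) {S : Finset ℕ} (hS : S ⊆ range k) :
    val w S + k ≤ 128 := by
  have h6 := h.le_six
  have hc : #S ≤ 6 := by
    have : #S ≤ k := by simpa using card_le_card hS
    omega
  have h1 : val w S ≤ #S • 20 := by
    refine sum_le_card_nsmul _ _ _ fun i _ => ?_
    have h2 : ∑ j ∈ S with j < i, w i j ≤ #{j ∈ S | j < i} • 3 :=
      sum_le_card_nsmul _ _ _ fun j _ => h.le_three i j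
    have h3 : #{j ∈ S | j < i} ≤ #S := card_filter_le _ _
    have h4 := h.diag_le i
    simp only [smul_eq_mul] at h2
    omega
  simp only [smul_eq_mul] at h1
  omega

lemma dense_iff (h : Adm w c) {k s : ℕ} (hk : k ≤ c) (hs : s ≤ 1) {P : Finset ℕ → Prop}
    [DecidablePred P] :
    dense (packVal w k) k s (pack k fun S => if P S then 128 else 0) = true ↔
      ∃ S ⊆ range k, P S ∧ #S + s < val w S :=
  CoreSearch.dense_iff (by have := h.le_six; omega) fun _ hS => h.val_add_le hk hS

lemma dense_mask (h : Adm w c) {k s : ℕ} (hk : k ≤ c) (hs : s ≤ 1) (v : ℕ) :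
    dense (packVal w k) k s (mask v k) = true ↔ ∃ S ⊆ range k, v ∉ S ∧ #S + s < val w S := by
  rw [mask_eq, h.dense_iff hk hs]

lemma dense_land_mask (h : Adm w c) {k s : ℕ} (hk : k ≤ c) (hs : s ≤ 1) (x y : ℕ) :
    dense (packVal w k) k s (Nat.land (mask x k) (mask y k)) = true ↔
      ∃ S ⊆ range k, (x ∉ S ∧ y ∉ S) ∧ #S + s < val w S := by
  rw [land_mask, h.dense_iff hk hs]

lemma entry_eq (h : Adm w c) {k i j : ℕ} (hi : i < k) (hj : j < k) :
    entry (rowsOf w k) k i j = w i j :=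
  entry_rowsOf h.symm (fun i _ j _ => by have := h.le_three i j; omega) hi hj

lemma nonApex_eq_false (h : Adm w c) {k : ℕ} (hk : k < c) (hk0 : 0 < k) :
    nonApex (packVal w k) k = false := by
  rw [Bool.eq_false_iff]
  intro H
  simp only [nonApex, List.all_eq_true, List.mem_range, h.dense_mask hk.le zero_le_one] at H
  obtain ⟨y, hy, hxy⟩ : ∃ y < c, 1 ≤ w (c - 1) y := by
    by_contra! hcon
    have h1 := h.deg (c - 1) (by omega)
    have h2 : ∑ i ∈ range c, w (c - 1) i = 0 :=
      sum_eq_zero fun i hi => by have := hcon i (mem_range.1 hi); omega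
    have h3 := hcon (c - 1) (by omega)
    unfold degK at h1
    omega
  obtain ⟨v, hv, hv'⟩ := h.del (c - 1) (by omega) y hy hxy
  obtain ⟨S, hS, hvS, hd⟩ : ∃ S ⊆ range k, v ∉ S ∧ #S < val w S := by
    rcases lt_or_ge v k with hvk | hvk
    · exact H v hvk
    · obtain ⟨S, hS, -, hd⟩ := H 0 hk0
      exact ⟨S, hS, fun hv => by have := mem_range.1 (hS hv); omega, hd⟩
  have := hv' S (hS.trans (range_subset_range.2 hk.le)) hvS
  have hc : c - 1 ∉ S := fun hc => by have := mem_range.1 (hS hc); omega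
  simp [hc] at this
  omega

lemma delBad_eq_false (h : Adm w c) {x y : ℕ} (hx : x < c) (hy : y < c) :
    delBad (rowsOf w c) (packVal w c) c x y = false := by
  rw [Bool.eq_false_iff]
  intro H
  simp only [delBad, Bool.and_eq_true, List.all_eq_true, List.mem_range, Bool.or_eq_true,
    h.dense_mask le_rfl le_rfl, h.dense_land_mask le_rfl zero_le_one, h.entry_eq hx hy,
    Nat.ble_eq] at H
  obtain ⟨v, hv, hv'⟩ := h.del x hx y hy H.1
  rcases H.2 v hv with (⟨S, hS, hvS, hd⟩ | ⟨S, hS, ⟨hvS, hxS⟩, hd⟩) | ⟨S, hS, ⟨hvS, hxS⟩, hd⟩ <;>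
    have := hv' S hS hvS
  · split_ifs at this <;> omega
  · simp [hxS] at this; omega
  · simp [hxS] at this; omega

lemma conBad_eq_false (h : Adm w c) {x y : ℕ} (hx : x < c) (hy : y < c) :
    conBad (rowsOf w c) (packVal w c) c x y = false := by
  rw [Bool.eq_false_iff]
  intro H
  simp only [conBad, Bool.and_eq_true, List.all_eq_true, List.mem_range, Bool.or_eq_true,
    h.dense_land_mask le_rfl zero_le_one, h.entry_eq hx hy, beq_eq_decide,
    Bool.not_eq_true', decide_eq_true_eq, decide_eq_false_iff_not] at H
  obtain ⟨⟨⟨hne, h1⟩, hz⟩, S, hS, ⟨hxS, hyS⟩, hd⟩ := H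
  have := h.con x hx y hy hne h1 (fun z hzc hzx hzy => by
    have := hz z hzc
    rw [h.entry_eq hx hzc, h.entry_eq hy hzc] at this
    tauto) S hS hxS hyS
  omega

lemma leaf_spec (h : Adm w c) {tbl : List (List (ℕ × List ℕ))}
    (H : leaf tbl (rowsOf w c) (packVal w c) c = true) :
    ∃ M ∈ tbl, M.length = c ∧ ∃ σ, σ ∈ embs (rowsOf w c) c M := by
  have hna : nonApex (packVal w c) c = true := by
    simp only [nonApex, List.all_eq_true, List.mem_range, h.dense_mask le_rfl zero_le_one]
    exact fun v _ => h.nonapex v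
  have hb : ((List.range c).any fun x => (List.range x.succ).any fun y =>
     delBad (rowsOf w c) (packVal w c) c x y || conBad (rowsOf w c) (packVal w c) c x y)
      = false := by
    simp only [List.any_eq_false, List.mem_range, Bool.not_eq_true, Bool.or_eq_false_iff]
    exact fun x hx y hy => ⟨h.delBad_eq_false hx (by omega), h.conBad_eq_false hx (by omega)⟩
  rw [leaf, hna, hb] at H
  simp only [Bool.not_true, Bool.false_or, List.any_eq_true, Bool.and_eq_true, Nat.beq_eq,
    Bool.not_eq_true', List.isEmpty_eq_false_iff_exists_mem] at H
  exact H

lemma search_spec (h : Adm w c) {tbl : List (List (ℕ × List ℕ))} {n k s key : ℕ} (hk : 2 ≤ k)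
    (hn : k + n = c) (hs : s + need w k + 3 * n = 2 * c) (hkey : k < c → keyOf w k ≤ key)
    (H : search tbl n k (rowsOf w k) (packVal w k) (code (degK w k) k) s key = true) :
    leaf tbl (rowsOf w c) (packVal w c) c = true := by
  induction n generalizing k s key with
  | zero =>
    obtain rfl : k = c := by omega
    exact H
  | succ n ih =>
    have hkc : k < c := by omega
    have hdig : ∀ j < k, digit (code (degK w k) k) k j = degK w k j := fun j hj =>
      digit_code hj fun i _ => h.degK_lt hkc.le i
    have hdeg : ∀ j, degK w (k + 1) j = degK w k j + w k j := fun j => by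
      rw [degK_succ, h.symm j k]
    have hlo : ∀ j < k + 1, (bif Nat.beq n 0 then 3 else 0) ≤ degK w k j + w k j := by
      intro j hj
      rw [beq_eq_decide]
      by_cases hn0 : n = 0
      · have := h.deg j (by omega)
        obtain rfl : c = k + 1 := by omega
        rw [hdeg] at this
        simpa [hn0] using this
      · simp [hn0]
    have hkeyk := hkey hkc
    have hown : degK w k k + w k k = w k 0 + w k 1 + 2 * w k k + ∑ i ∈ Ico 2 k, w k i := by
      unfold degK
      rw [← sum_range_add_sum_Ico _ hk, sum_range_succ, sum_range_one]
      ring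
    have hsum : ∑ j ∈ Ico 2 k, max 3 (degK w k j + w k j) + ∑ i ∈ Ico 2 k, w k i =
        ∑ j ∈ Ico 2 k, max 3 (degK w k j) + ∑ j ∈ Ico 2 k, cost (degK w k j) (w k j) := by
      rw [← sum_add_distrib, ← sum_add_distrib]
      refine sum_congr rfl fun j _ => ?_
      unfold cost
      omega
    have hneed := need_succ w hk h.symm
    have hle := need_le w (k := k + 1) (n := n) (by omega) h.symm
    have hc2 : need w c ≤ 2 * c := by
      refine le_trans (le_of_eq ?_) h.budget
      unfold need
      rw [add_comm, ← add_assoc]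
      congr 2
      exact sum_congr rfl fun j hj => max_eq_right (h.deg j (mem_Ico.1 hj).2)
    rw [show k + 1 + n = c by omega] at hle
    have hA : pack 2 (fun S => ∑ i ∈ S, w k i) =
        w k 0 + w k 1 + w k 1 * 256 + w k 0 * 65536 := by
      simp [pack, shift]; ring
    have hR : code (w k) 2 = 64 * w k 0 + w k 1 := by simp [code]
    have hD : 64 * (code (degK w k) k + code (w k) k) + (degK w k k + w k k) =
        code (degK w (k + 1)) (k + 1) := by
      rw [code_add, code, hdeg]
      congr 2
      exact code_congr fun i _ => (hdeg i).symm
    simp only [search, force_eq] at H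
    unfold keyOf at hkeyk
    have hneedk : need w k = w 0 0 + w 1 1 + ∑ j ∈ Ico 2 k, max 3 (degK w k j) := rfl
    rw [all4_iff] at H
    have H := H (w k 0) (h.le_three _ _)
    rw [hdig 0 (by omega), ble_eq_decide, ble_eq_decide, decide_eq_true (hlo 0 (by omega)),
      decide_eq_true (by omega), Bool.and_self, Bool.not_true, Bool.false_or, all4_iff] at H
    have H := H (w k 1) (h.le_three _ _)
    rw [hdig 1 (by omega), ble_eq_decide, ble_eq_decide, decide_eq_true (hlo 1 (by omega)),
      decide_eq_true (by omega), Bool.and_self, Bool.not_true, Bool.false_or, all3_iff] at H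
    have H := H (w k k) (h.diag_le _)
    rw [ble_eq_decide, ble_eq_decide, decide_eq_true hkeyk,
      decide_eq_true (by omega), Bool.and_self, Bool.not_true, Bool.false_or, ← hA, ← hR] at H
    have H := gen_spec (h.le_three k) hdig (fun i hi => hlo i (by omega)) (by omega) (by omega) H
    rw [← hown, ← packVal_succ, hD, ble_eq_decide, ble_eq_decide,
      decide_eq_true (hlo k (by omega)), decide_eq_true (by omega), Bool.and_self, Bool.not_true,
      Bool.false_or, Nat.succ_eq_add_one] at H
    have hd0 : dense (packVal w (k + 1)) (k + 1) 1 (mask 0 (k + 1)) = false := by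
      rw [Bool.eq_false_iff, ne_eq, h.dense_mask (by omega) le_rfl]
      rintro ⟨S, hS, h0, hd⟩
      have := h.good0 S (hS.trans (range_subset_range.2 (by omega))) h0
      omega
    have hd1 : dense (packVal w (k + 1)) (k + 1) 1 (mask 1 (k + 1)) = false := by
      rw [Bool.eq_false_iff, ne_eq, h.dense_mask (by omega) le_rfl]
      rintro ⟨S, hS, h0, hd⟩
      have := h.good1 S (hS.trans (range_subset_range.2 (by omega))) h0
      omega
    have hna : (Nat.ble 1 n && nonApex (packVal w (k + 1)) (k + 1)) = false := by
      rw [ble_eq_decide]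
      rcases n.eq_zero_or_pos with rfl | hn0
      · simp
      · rw [h.nonApex_eq_false (by omega) (by omega), Bool.and_false]
    rw [hd0, hd1, hna, Bool.false_or, Bool.false_or, Bool.false_or] at H
    exact ih (by omega) (by omega) (by omega) (fun hk1 => h.key_anti k hk hk1) H

lemma start_spec (h : Adm w c) {tbl : List (List (ℕ × List ℕ))} (H : start tbl c = true) :
    ∃ M ∈ tbl, M.length = c ∧ ∃ σ, σ ∈ embs (rowsOf w c) c M := by
  have h2 := h.two_le
  have h6 := h.le_six
  have hd0 := h.diag_le 0
  have hd1 := h.diag_le 1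
  have h10 := h.le_three 1 0
  have hle := need_le w (k := 2) (n := c - 2) le_rfl h.symm
  have hc2 : need w c ≤ 2 * c := by
    refine le_trans (le_of_eq ?_) h.budget
    unfold need
    rw [add_comm, ← add_assoc]
    congr 2
    exact sum_congr rfl fun j hj => max_eq_right (h.deg j (mem_Ico.1 hj).2)
  have hn2 : need w 2 = w 0 0 + w 1 1 := by simp [need]
  rw [show 2 + (c - 2) = c by omega] at hle
  simp only [start, List.all_eq_true] at H
  have H := H (w 0 0) (by simp; omega) (w 1 1) (by simp; omega) (w 1 0) (by simp; omega)
  rw [ble_eq_decide, ble_eq_decide, decide_eq_true h.diag_anti, decide_eq_true (by omega),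
    Bool.and_self, Bool.not_true, Bool.false_or] at H
  refine h.leaf_spec (h.search_spec (n := c - 2) (k := 2) (s := 6 - c - w 0 0 - w 1 1)
    (key := 1000) le_rfl (by omega) (by omega) (fun _ => ?_) ?_)
  · have := h.le_three 2 0
    have := h.le_three 2 1
    have := h.le_three 2 2
    unfold keyOf
    omega
  · have hX : packVal w 2 = w 0 0 + w 1 1 + w 1 0 + (w 1 1 + 1) * 256 + (w 0 0 + 1) * 65536 +
        2 * 16777216 := by
      have h1 : pack 1 (fun S => ∑ i ∈ S, w 1 i) = w 1 0 := by simp [pack]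
      have h0 : pack 0 (fun S => ∑ i ∈ S, w 0 i) = 0 := by simp [pack]
      rw [packVal_succ, packVal_succ, h1, h0]
      simp [packVal, pack, val, ones, shift]
      ring
    have hD : code (degK w 2) 2 = 64 * (w 1 0 + 2 * w 0 0) + (w 1 0 + 2 * w 1 1) := by
      simp [code, degK, sum_range_succ, h.symm 0 1]
      ring
    rw [hX, hD]
    simpa only [rowsOf, code, mul_zero, zero_add] using H

end Adm

/-- The lower triangular entries of a matrix given by its rows in reverse order. -/
def matEntry : List (ℕ × List ℕ) → ℕ → ℕ → ℕ
  | [], _, _ => 0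
  | r :: rs, i, j =>
    bif Nat.beq i rs.length then (bif Nat.beq j i then r.1 else look r.2 j) else matEntry rs i j

lemma look_mem {σ : List ℕ} {j : ℕ} (hj : j < σ.length) : look σ j ∈ σ := by
  induction σ with
  | nil => simp at hj
  | cons a σ ih =>
    rw [look, beq_eq_decide]
    rcases Nat.lt_succ_iff_lt_or_eq.1 (by simpa using hj) with h | h
    · simp [h.ne, ih h]
    · simp [h]

lemma look_cons_length {σ : List ℕ} {a : ℕ} : look (a :: σ) σ.length = a := by
  simp [look]

lemma look_cons_lt {σ : List ℕ} {a j : ℕ} (h : j < σ.length) : look (a :: σ) j = look σ j := by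
  simp [look, beq_eq_decide, h.ne]

lemma look_inj {σ : List ℕ} (hσ : σ.Nodup) {i j : ℕ} (hi : i < σ.length) (hj : j < σ.length)
    (h : look σ i = look σ j) : i = j := by
  induction σ with
  | nil => simp at hi
  | cons a σ ih =>
    rw [List.nodup_cons] at hσ
    rw [List.length_cons, Nat.lt_succ_iff_lt_or_eq] at hi hj
    rcases hi with hi | rfl <;> rcases hj with hj | rfl
    · rw [look_cons_lt hi, look_cons_lt hj] at h
      exact ih hσ.2 hi hj h
    · rw [look_cons_lt hi, look_cons_length] at h
      exact absurd (look_mem hi) (h ▸ hσ.1)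
    · rw [look_cons_lt hj, look_cons_length] at h
      exact absurd (look_mem hj) (h ▸ hσ.1)
    · rfl

lemma embs_spec {rows : List (ℕ × ℕ)} {k : ℕ} {M : List (ℕ × List ℕ)} {σ : List ℕ}
    (h : σ ∈ embs rows k M) :
    σ.length = M.length ∧ σ.Nodup ∧ (∀ i ∈ σ, i < k) ∧
      ∀ i < M.length, ∀ j ≤ i, matEntry M i j = entry rows k (look σ i) (look σ j) := by
  induction M generalizing σ with
  | nil => simp only [embs, List.mem_singleton] at h; subst h; simp
  | cons r rs ih =>
    simp only [embs, List.mem_flatMap, List.mem_range] at h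
    obtain ⟨τ, hτ, i, hi, hσ⟩ := h
    rw [Bool.cond_eq_ite] at hσ
    split_ifs at hσ with hc
    swap
    · simp at hσ
    rw [List.mem_singleton] at hσ
    subst hσ
    simp only [Bool.and_eq_true, Bool.not_eq_true', List.any_eq_false, Nat.beq_eq, List.all_eq_true,
      List.mem_range] at hc
    obtain ⟨⟨h1, h2⟩, h3⟩ := hc
    obtain ⟨hl, hn, hk, hm⟩ := ih hτ
    refine ⟨by simp [hl], List.nodup_cons.2 ⟨fun hmem => h1 i hmem rfl, hn⟩, ?_, ?_⟩
    · simp only [List.mem_cons, forall_eq_or_imp]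
      exact ⟨hi, hk⟩
    · intro a ha b hb
      rw [List.length_cons, Nat.lt_succ_iff_lt_or_eq] at ha
      rcases ha with ha | rfl
      · rw [look_cons_lt (by omega), look_cons_lt (by omega), ← hm a ha b hb]
        simp [matEntry, beq_eq_decide, ha.ne]
      · rw [← hl, look_cons_length, matEntry, beq_eq_decide, beq_eq_decide]
        rcases hb.lt_or_eq with hb | rfl
        · rw [look_cons_lt (by omega), ← h3 b hb]
          simp [hl, hb.ne]
        · rw [hl, decide_eq_true rfl, ← hl, look_cons_length]
          exact h2

lemma Adm.exists_embedding {w : ℕ → ℕ → ℕ} {c : ℕ} (h : Adm w c)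
    {tbl : List (List (ℕ × List ℕ))} (H : start tbl c = true) :
    ∃ M ∈ tbl, M.length = c ∧ ∃ f : ℕ → ℕ, (∀ i < c, f i < c) ∧
      (∀ i < c, ∀ j < c, f i = f j → i = j) ∧ ∀ i < c, ∀ j ≤ i, matEntry M i j = w (f i) (f j) := by
  obtain ⟨M, hM, rfl, σ, hσ⟩ := h.start_spec H
  obtain ⟨hl, hn, hk, hm⟩ := embs_spec hσ
  refine ⟨M, hM, rfl, look σ, fun i hi => hk _ (look_mem (by omega)),
    fun i hi j hj => look_inj hn (by omega) (by omega), fun i hi j hj => ?_⟩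
  rw [hm i hi j hj, h.entry_eq (hk _ (look_mem (by omega))) (hk _ (look_mem (by omega)))]

/-! ### Pseudoforests and edge counts -/

lemma Connected.card_le_of_cycle {W : Type} [Finite W] {K : SimpleGraph W} (hK : K.Connected)
    {u : W} {c : K.Walk u u} (hc : c.IsCycle) : Nat.card W ≤ Nat.card K.edgeSet := by
  have h1 := hK.card_vert_le_card_edgeSet_add_one
  by_contra h2
  have := (isTree_iff_connected_and_card.2 ⟨hK, by omega⟩).isAcyclic c
  exact this hc

lemma exists_cycle_of_card_le {W : Type} [Finite W] {K : SimpleGraph W} (hK : K.Connected)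
    (h : Nat.card W ≤ Nat.card K.edgeSet) : ∃ (u : W) (c : K.Walk u u), c.IsCycle := by
  by_contra! hcon
  have := (isTree_iff_connected_and_card.1 ⟨hK, fun u c => hcon u c⟩).2
  omega

lemma card_deleteEdges {W : Type} [Finite W] {K : SimpleGraph W} {e : Sym2 W} (he : e ∈ K.edgeSet) :
    Nat.card (K.deleteEdges {e}).edgeSet + 1 = Nat.card K.edgeSet := by
  rw [edgeSet_deleteEdges, Nat.card_coe_set_eq, Nat.card_coe_set_eq]
  exact Set.ncard_sdiff_singleton_add_one he

lemma connected_deleteEdges {W : Type} {K : SimpleGraph W} (hK : K.Connected) {u : W}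
    {c : K.Walk u u} (hc : c.IsCycle) {e : Sym2 W} (he : e ∈ c.edges) :
    (K.deleteEdges {e}).Connected := by
  induction e with
  | h x y =>
    refine hK.connected_delete_edge_of_not_isBridge fun hb => ?_
    exact (isBridge_iff_forall_cycle_notMem (c.edges_subset_edgeSet he)).1 hb c hc he

lemma exists_two_cycles {W : Type} [Finite W] {K : SimpleGraph W} (hK : K.Connected)
    (h : Nat.card W < Nat.card K.edgeSet) :
    ∃ (u v : W) (c : K.Walk u u) (c' : K.Walk v v) (e : Sym2 W), c.IsCycle ∧ c'.IsCycle ∧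
      e ∈ c.edges ∧ e ∉ c'.edges := by
  obtain ⟨u, c, hc⟩ := exists_cycle_of_card_le hK h.le
  obtain ⟨e, he⟩ : ∃ e, e ∈ c.edges := List.exists_mem_of_ne_nil _ (by simpa using hc.ne_nil)
  have heK := c.edges_subset_edgeSet he
  have h1 := card_deleteEdges heK
  obtain ⟨v, c', hc'⟩ := exists_cycle_of_card_le (connected_deleteEdges hK hc he) (by omega)
  refine ⟨u, v, c, c'.mapLe (deleteEdges_le _), e, hc, hc'.mapLe _, he, fun h2 => ?_⟩
  rw [Walk.edges_mapLe_eq_edges] at h2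
  simpa using c'.edges_subset_edgeSet h2

lemma edges_subset_of_card_le {W : Type} [Finite W] {K : SimpleGraph W} (hK : K.Connected)
    (h : Nat.card K.edgeSet ≤ Nat.card W) {u v : W} {c : K.Walk u u} {c' : K.Walk v v}
    (hc : c.IsCycle) (hc' : c'.IsCycle) {e : Sym2 W} (he : e ∈ c.edges) : e ∈ c'.edges := by
  by_contra h2
  have h1 := card_deleteEdges (c.edges_subset_edgeSet he)
  have := Connected.card_le_of_cycle (connected_deleteEdges hK hc he)
    (hc'.toDeleteEdges K ({e} : Set (Sym2 W)) fun e' he' h3 => h2 (Set.mem_singleton_iff.1 h3 ▸ he'))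
  omega

open Classical in
/-- The degree sum of the subgraph induced by `S`. -/
noncomputable def dsum {V : Type} (G : SimpleGraph V) (S : Finset V) : ℕ :=
  ∑ a ∈ S, ∑ b ∈ S, if G.Adj a b then 1 else 0

lemma dsum_eq {V : Type} (G : SimpleGraph V) (S : Finset V) :
    dsum G S = 2 * Nat.card (G.induce (S : Set V)).edgeSet := by
  classical
  rw [Nat.card_eq_fintype_card, ← Set.toFinset_card]
  change _ = 2 * #(G.induce (S : Set V)).edgeFinset
  rw [← sum_degrees_eq_twice_card_edges]
  unfold dsum
  rw [← sum_coe_sort S]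
  refine sum_congr rfl fun a _ => ?_
  rw [← card_neighborFinset_eq_degree, neighborFinset_eq_filter, card_filter, ← sum_coe_sort S]
  rfl

lemma dsum_disjUnion {V : Type} [DecidableEq V] (G : SimpleGraph V) {S T : Finset V} (hST : Disjoint S T)
    (h : ∀ a ∈ S, ∀ b ∈ T, ¬ G.Adj a b) : dsum G (S ∪ T) = dsum G S + dsum G T := by
  unfold dsum
  rw [sum_union hST]
  congr 1
  · refine sum_congr rfl fun a ha => ?_
    rw [sum_union hST, add_eq_left]
    exact sum_eq_zero fun b hb => if_neg (h a ha b hb)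
  · refine sum_congr rfl fun a ha => ?_
    rw [sum_union hST, add_eq_right]
    exact sum_eq_zero fun b hb => if_neg fun hab => h b hb a ha hab.symm

lemma dsum_le_of_pseudoforest {V : Type} {G : SimpleGraph V} (h : Pseudoforest G) (S : Finset V) :
    dsum G S ≤ 2 * #S := by
  classical
  induction S using Finset.strongInduction with
  | H S ih =>
  by_contra! hS
  by_cases hK : (G.induce (S : Set V)).Preconnected
  · have hne : S.Nonempty := by
      rw [nonempty_iff_ne_empty]
      rintro rfl
      simp [dsum] at hS
    have : Nonempty (S : Set V) := hne.coe_sort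
    rw [dsum_eq] at hS
    obtain ⟨u, v, c, c', e, hc, hc', he, he'⟩ := exists_two_cycles ⟨hK⟩
      (by rw [Nat.card_coe_set_eq, Set.ncard_coe_finset]; omega)
    have hinj : Function.Injective (Embedding.induce (G := G) (S : Set V)).toHom :=
      (Embedding.induce (G := G) (S : Set V)).injective
    have := (h _ _ (hc.map hinj) (hc'.map hinj) ((hK u v).map _) (e.map Subtype.val)).1
    rw [Walk.edges_map, Walk.edges_map] at this
    obtain ⟨e2, he2, h2⟩ := List.mem_map.1 (this (List.mem_map_of_mem he))
    have : e2 = e := Sym2.map.injective Subtype.val_injective h2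
    exact he' (this ▸ he2)
  · simp only [Preconnected, not_forall] at hK
    obtain ⟨x, y, hxy⟩ := hK
    set T := S.filter fun z => ∃ hz : z ∈ S, (G.induce (S : Set V)).Reachable x ⟨z, hz⟩ with hT
    have hxT : x.1 ∈ T := mem_filter.2 ⟨x.2, x.2, Reachable.refl _⟩
    have hyT : y.1 ∉ T := fun hy => hxy (mem_filter.1 hy).2.2
    have hTS : T ⊆ S := filter_subset _ _
    have h1 := ih T (Finset.ssubset_iff_subset_ne.2 ⟨hTS, fun hE => hyT (hE.symm.subset y.2)⟩)
    have h2 := ih (S \ T) (Finset.ssubset_iff_subset_ne.2 ⟨sdiff_subset, fun hE => by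
      exact (mem_sdiff.1 (hE.symm.subset x.2)).2 hxT⟩)
    have h3 := dsum_disjUnion G (disjoint_sdiff (s := T) (t := S)) (by
      intro a ha b hb hab
      rw [mem_sdiff] at hb
      obtain ⟨haS, har⟩ := (mem_filter.1 ha).2
      refine hb.2 (mem_filter.2 ⟨hb.1, hb.1, har.trans (Adj.reachable ?_)⟩)
      exact hab)
    rw [union_sdiff_of_subset hTS] at h3
    have h4 := card_sdiff_add_card_eq_card hTS
    omega

lemma pseudoforest_of_dsum_le {V : Type} [Finite V] {G : SimpleGraph V}
    (h : ∀ S : Finset V, dsum G S ≤ 2 * #S) : Pseudoforest G := by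
  classical
  have : Fintype V := Fintype.ofFinite V
  have key : ∀ ⦃u v : V⦄ (c : G.Walk u u) (c' : G.Walk v v), c.IsCycle → c'.IsCycle →
      G.Reachable u v → ∀ e, e ∈ c.edges → e ∈ c'.edges := by
    intro u v c c' hc hc' huv e he
    set S : Finset V := univ.filter fun z => G.Reachable u z with hSdef
    have hcS : ∀ z ∈ c.support, z ∈ (S : Set V) := fun z hz => by
      simpa [hSdef] using ⟨c.takeUntil z hz⟩
    have hcS' : ∀ z ∈ c'.support, z ∈ (S : Set V) := fun z hz => by
      simpa [hSdef] using huv.trans ⟨c'.takeUntil z hz⟩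
    have hK : (G.induce (S : Set V)).Connected := by
      have h1 : (S : Set V) = (G.connectedComponentMk u).supp := by
        ext z
        simp [hSdef, ConnectedComponent.eq, reachable_comm]
      rw [h1]
      exact (G.connectedComponentMk u).connected_toSimpleGraph
    have hS := h S
    rw [dsum_eq] at hS
    have hinj : Function.Injective (Embedding.induce (G := G) (S : Set V)).toHom :=
      (Embedding.induce (G := G) (S : Set V)).injective
    have e1 := Walk.map_induce c hcS
    have e2 := Walk.map_induce c' hcS'
    have hd : (c.induce _ hcS).IsCycle := by
      rw [← Walk.isCycle_map_iff_of_injective hinj, e1]; exact hc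
    have hd' : (c'.induce _ hcS').IsCycle := by
      rw [← Walk.isCycle_map_iff_of_injective hinj, e2]; exact hc'
    have e3 : c.edges = (c.induce _ hcS).edges.map (Sym2.map Subtype.val) :=
      (congrArg Walk.edges e1).symm.trans (Walk.edges_map _ _)
    have e4 : c'.edges = (c'.induce _ hcS').edges.map (Sym2.map Subtype.val) :=
      (congrArg Walk.edges e2).symm.trans (Walk.edges_map _ _)
    rw [e3] at he
    obtain ⟨e', he', rfl⟩ := List.mem_map.1 he
    rw [e4]
    refine List.mem_map_of_mem (edges_subset_of_card_le hK ?_ hd hd' he')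
    rw [Nat.card_coe_set_eq (S : Set V), Set.ncard_coe_finset]
    omega
  exact fun u v c c' hc hc' huv e => ⟨key c c' hc hc' huv e, key c' c hc' hc huv.symm e⟩

lemma dsum_map {V W : Type} {G : SimpleGraph V} {H : SimpleGraph W} (f : H ↪g G) (S : Finset W) :
    dsum G (S.map f.toEmbedding) = dsum H S := by
  classical
  simp only [dsum, sum_map]
  refine sum_congr rfl fun a _ => sum_congr rfl fun b _ => ?_
  exact if_congr f.map_adj_iff rfl rfl

lemma pseudoforest_induce_iff {V : Type} [Finite V] {G : SimpleGraph V} (s : Set V) :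
    Pseudoforest (G.induce s) ↔ ∀ S : Finset V, (S : Set V) ⊆ s → dsum G S ≤ 2 * #S := by
  classical
  constructor
  · intro h S hS
    have := dsum_le_of_pseudoforest h (S.subtype (· ∈ s))
    rw [← dsum_map (Embedding.induce s), ← card_map (Embedding.induce (G := G) s).toEmbedding] at this
    have h2 : (S.subtype (· ∈ s)).map (Embedding.induce (G := G) s).toEmbedding = S :=
      subtype_map_of_mem fun x hx => hS hx
    rwa [h2] at this
  · intro h
    refine pseudoforest_of_dsum_le fun S => ?_
    rw [← dsum_map (Embedding.induce s), ← card_map (Embedding.induce (G := G) s).toEmbedding]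
    refine h _ fun x hx => ?_
    simp only [coe_map, Set.mem_image] at hx
    obtain ⟨y, -, rfl⟩ := hx
    exact y.2

lemma apexPseudoforest_of_le {V : Type} [Finite V] {G : SimpleGraph V} (v : V)
    (h : ∀ S : Finset V, v ∉ S → dsum G S ≤ 2 * #S) : ApexPseudoforest G :=
  ⟨{v}, Set.subsingleton_singleton, (pseudoforest_induce_iff _).2 fun S hS =>
    h S fun hv => hS hv rfl⟩

lemma ApexPseudoforest.exists_le {V : Type} [Finite V] [Nonempty V] {G : SimpleGraph V}
    (h : ApexPseudoforest G) : ∃ v, ∀ S : Finset V, v ∉ S → dsum G S ≤ 2 * #S := by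
  obtain ⟨s, hs, h⟩ := h
  rw [pseudoforest_induce_iff] at h
  rcases hs.eq_empty_or_singleton with rfl | ⟨v, rfl⟩
  · exact ⟨Classical.arbitrary V, fun S _ => h S (by simp)⟩
  · exact ⟨v, fun S hv => h S fun x hx hxv => hv (by rw [Set.mem_singleton_iff] at hxv; exact hxv ▸ hx)⟩

/-! ### Minimality of obstructions -/

lemma connected_induce_singleton {V : Type} (G : SimpleGraph V) (v : V) :
    (G.induce {v}).Connected :=
  have : Nonempty ({v} : Set V) := ⟨⟨v, rfl⟩⟩
  ⟨Preconnected.of_subsingleton⟩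

lemma isMinorOf_of_injective {V W : Type} {G : SimpleGraph V} {H : SimpleGraph W} (f : W → V)
    (hf : Function.Injective f) (hadj : ∀ a b, H.Adj a b → G.Adj (f a) (f b)) :
    IsMinorOf H G :=
  ⟨fun w => {f w}, fun w => connected_induce_singleton G (f w),
    fun _ _ h => Set.disjoint_singleton.2 (hf.ne h),
    fun a b h => ⟨f a, rfl, f b, rfl, hadj a b h⟩⟩

lemma not_iso_of_ne {V : Type} [Finite V] {y : V} {H : SimpleGraph ({y}ᶜ : Set V)}
    {G : SimpleGraph V} : IsEmpty (H ≃g G) := by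
  refine ⟨fun e => ?_⟩
  have h1 := Nat.card_congr e.toEquiv
  rw [Nat.card_coe_set_eq] at h1
  have h2 := Set.ncard_add_ncard_compl ({y} : Set V)
  rw [Set.ncard_singleton] at h2
  omega

lemma exists_le_of_apexPseudoforest_induce {V : Type} [Finite V] {K : SimpleGraph V} {y z : V}
    (hzy : z ≠ y) (h : ApexPseudoforest (K.induce {y}ᶜ)) :
    ∃ v ≠ y, ∀ S : Finset V, v ∉ S → y ∉ S → dsum K S ≤ 2 * #S := by
  classical
  have : Nonempty ({y}ᶜ : Set V) := ⟨⟨z, hzy⟩⟩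
  obtain ⟨v, hv⟩ := ApexPseudoforest.exists_le h
  refine ⟨v.1, v.2, fun S hvS hyS => ?_⟩
  have h1 := hv (S.subtype (· ∈ ({y}ᶜ : Set V))) (by simpa using hvS)
  have h2 : (S.subtype (· ∈ ({y}ᶜ : Set V))).map
      (Embedding.induce (G := K) ({y}ᶜ : Set V)).toEmbedding = S :=
    subtype_map_of_mem fun x hx hxy => hyS (by rw [Set.mem_singleton_iff] at hxy; exact hxy ▸ hx)
  rw [← dsum_map (Embedding.induce _),
    ← card_map (Embedding.induce (G := K) ({y}ᶜ : Set V)).toEmbedding] at h1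
  rwa [h2] at h1

open Classical in
/-- The number of neighbours of `u` in `S`. -/
noncomputable def nbrs {V : Type} (G : SimpleGraph V) (S : Finset V) (u : V) : ℕ :=
  ∑ b ∈ S, if G.Adj u b then 1 else 0

lemma dsum_insert {V : Type} [DecidableEq V] (G : SimpleGraph V) {S : Finset V} {u : V}
    (hu : u ∉ S) : dsum G (insert u S) = dsum G S + 2 * nbrs G S u := by
  classical
  unfold dsum nbrs
  have h : ∀ a ∈ S, (∑ b ∈ insert u S, if G.Adj a b then 1 else 0) =
      (if G.Adj u a then 1 else 0) + ∑ b ∈ S, if G.Adj a b then 1 else 0 := fun a _ => by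
    rw [sum_insert hu]
    congr 1
    exact if_congr (G.adj_comm a u) rfl rfl
  rw [sum_insert hu, sum_insert hu, if_neg (G.loopless.irrefl u), sum_congr rfl h, sum_add_distrib]
  ring

lemma dsum_le_of_le {V : Type} {G H : SimpleGraph V} {S : Finset V}
    (h : ∀ a ∈ S, ∀ b ∈ S, G.Adj a b → H.Adj a b) : dsum G S ≤ dsum H S := by
  refine sum_le_sum fun a ha => sum_le_sum fun b hb => ?_
  have := h a ha b hb
  split_ifs <;> simp_all

section Obs

variable {V : Type} [Finite V] {G : SimpleGraph V}

lemma Obs.nonapex (h : ObsApexPseudoforest G) (v : V) :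
    ∃ S : Finset V, v ∉ S ∧ 2 * #S < dsum G S := by
  by_contra! hcon
  exact h.1 (apexPseudoforest_of_le v hcon)

lemma Obs.exists_ne (h : ObsApexPseudoforest G) (v : V) : ∃ z, z ≠ v := by
  obtain ⟨S, hv, hS⟩ := Obs.nonapex h v
  obtain ⟨z, hz⟩ : S.Nonempty := by
    rw [nonempty_iff_ne_empty]
    rintro rfl
    simp [dsum] at hS
  exact ⟨z, fun hzv => hv (hzv ▸ hz)⟩

omit [Finite V] in
lemma Obs.nonempty (h : ObsApexPseudoforest G) : Nonempty V := by
  by_contra hV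
  rw [not_nonempty_iff] at hV
  exact h.1 ⟨∅, Set.subsingleton_empty, fun u => hV.elim u.1⟩

lemma Obs.delete_vertex (h : ObsApexPseudoforest G) (u : V) :
    ∃ v ≠ u, ∀ S : Finset V, v ∉ S → u ∉ S → dsum G S ≤ 2 * #S := by
  obtain ⟨z, hz⟩ := Obs.exists_ne h u
  exact exists_le_of_apexPseudoforest_induce hz <| h.2 _ _
    (isMinorOf_of_injective Subtype.val Subtype.val_injective fun a b hab => hab) not_iso_of_ne

lemma Obs.delete_edge (h : ObsApexPseudoforest G) {x y : V} (hxy : G.Adj x y) [DecidableEq V] :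
    ∃ v, ∀ S : Finset V, v ∉ S → dsum G S ≤ 2 * #S + if x ∈ S ∧ y ∈ S then 2 else 0 := by
  classical
  have := Obs.nonempty h
  have hc := card_deleteEdges (K := G) (e := s(x, y)) hxy
  obtain ⟨H, hH, v, hv⟩ : ∃ H : SimpleGraph V, (∀ a b, G.Adj a b → s(a, b) ≠ s(x, y) → H.Adj a b) ∧
      ∃ v, ∀ S : Finset V, v ∉ S → dsum H S ≤ 2 * #S :=
    ⟨G.deleteEdges {s(x, y)}, fun a b hab h2 => by rw [deleteEdges_adj]; exact ⟨hab, h2⟩,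
      ApexPseudoforest.exists_le <| h.2 V (G.deleteEdges {s(x, y)})
        (isMinorOf_of_injective id Function.injective_id fun a b hab => deleteEdges_le _ hab)
        ⟨fun e => by have := Nat.card_congr e.mapEdgeSet; omega⟩⟩
  refine ⟨v, fun S hvS => ?_⟩
  have h1 : ∀ a b, (if G.Adj a b then 1 else 0) ≤ (if H.Adj a b then 1 else 0) +
      ((if x = a then (if y = b then 1 else 0) else 0) +
        if y = a then (if x = b then 1 else 0) else 0) := by
    intro a b
    by_cases hab : G.Adj a b
    · by_cases h2 : s(a, b) = s(x, y)
      · rcases Sym2.eq_iff.1 h2 with ⟨rfl, rfl⟩ | ⟨rfl, rfl⟩ <;> simp [hab] <;> omega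
      · simp [hab, hH a b hab h2]
    · simp [hab]
  refine (sum_le_sum fun a _ => sum_le_sum fun b _ => h1 a b).trans ?_
  simp only [sum_add_distrib]
  refine add_le_add (hv S hvS) ?_
  by_cases hx : x ∈ S <;> by_cases hy : y ∈ S <;> simp [sum_ite_irrel, hx, hy]

/-- The graph obtained from `G` by moving all edges at `y` to `x`. -/
def moveEdges (G : SimpleGraph V) (x y : V) : SimpleGraph V :=
  SimpleGraph.fromRel fun a b => G.Adj a b ∨ a = x ∧ G.Adj y b

lemma Obs.contract (h : ObsApexPseudoforest G) {x y : V} (hxy : G.Adj x y)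
    (hz : ∀ z, G.Adj x z → ¬ G.Adj y z) (S : Finset V) (hx : x ∉ S) (hy : y ∉ S) :
    dsum G S ≤ 2 * #S := by
  classical
  set K := moveEdges G x y with hK
  have hGK : ∀ {a b}, G.Adj a b → K.Adj a b := fun hab => ⟨hab.ne, .inl (.inl hab)⟩
  have hKx : ∀ {b}, b ≠ x → G.Adj y b → K.Adj x b := fun hb hab => ⟨hb.symm, .inl (.inr ⟨rfl, hab⟩)⟩
  have hmin : IsMinorOf (K.induce {y}ᶜ) G := by
    refine ⟨fun w => if w.1 = x then {x, y} else {w.1}, fun w => ?_, fun a b hab => ?_,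
      fun a b hab => ?_⟩
    · by_cases hw : w.1 = x
      · have h2 : (if w.1 = x then {x, y} else {w.1} : Set V) = {x, y} := if_pos hw
        dsimp only
        rw [h2]
        exact induce_pair_connected_of_adj hxy
      · have h2 : (if w.1 = x then {x, y} else {w.1} : Set V) = {w.1} := if_neg hw
        dsimp only
        rw [h2]
        exact connected_induce_singleton G _
    · have ha := a.2
      have hb := b.2
      have hne : a.1 ≠ b.1 := fun h => hab (Subtype.ext h)
      simp only [Set.mem_compl_iff, Set.mem_singleton_iff] at ha hb
      rw [Set.disjoint_left]
      intro z hz1 hz2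
      dsimp only at hz1 hz2
      split_ifs at hz1 hz2 with h1 h2 h2 <;> simp at hz1 hz2 <;> aesop
    · have ha := a.2
      have hb := b.2
      simp only [Set.mem_compl_iff, Set.mem_singleton_iff] at ha hb
      have hmem : ∀ w : ({y}ᶜ : Set V), w.1 ∈ (if w.1 = x then {x, y} else {w.1} : Set V) := by
        intro w; split_ifs with h <;> simp [h]
      have hy' : ∀ w : ({y}ᶜ : Set V), w.1 = x →
          y ∈ (if w.1 = x then {x, y} else {w.1} : Set V) := by
        intro w hw; simp [hw]
      obtain ⟨-, (hab | ⟨hax, hab⟩) | (hab | ⟨hbx, hab⟩)⟩ := hab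
      · exact ⟨a, hmem a, b, hmem b, hab⟩
      · exact ⟨y, hy' a hax, b, hmem b, hab⟩
      · exact ⟨a, hmem a, b, hmem b, hab.symm⟩
      · exact ⟨a, hmem a, y, hy' b hbx, hab.symm⟩
  obtain ⟨v, hvy, hv⟩ := exists_le_of_apexPseudoforest_induce hxy.ne (h.2 _ _ hmin not_iso_of_ne)
  by_cases hvx : v = x
  · subst hvx
    exact (dsum_le_of_le fun a _ b _ hab => hGK hab).trans (hv S hx hy)
  exfalso
  obtain ⟨T, hvT, hT⟩ := Obs.nonapex h v
  set R := (T.erase x).erase y with hR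
  have hxR : x ∉ R := by simp [hR]
  have hyR : y ∉ R := by simp [hR]
  have hvR : v ∉ R := by simp [hR, hvT]
  have h1 := hv (insert x R) (by simp [hvR, hvx]) (by simp [hyR, hxy.ne'])
  have h0 := hv R hvR hyR
  rw [dsum_insert K hxR, card_insert_of_notMem hxR] at h1
  have hRR : dsum G R ≤ dsum K R := dsum_le_of_le fun a _ b _ hab => hGK hab
  have hxn : nbrs G R x + nbrs G R y ≤ nbrs K R x := by
    unfold nbrs
    rw [← sum_add_distrib]
    refine sum_le_sum fun b hb => ?_
    have hbx : b ≠ x := fun hbx => hxR (hbx ▸ hb)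
    by_cases h1 : G.Adj x b
    · simp [h1, hz b h1, hGK h1]
    · by_cases h2 : G.Adj y b
      · simp [h1, h2, hKx hbx h2]
      · simp [h1, h2]
  by_cases hxT : x ∈ T <;> by_cases hyT : y ∈ T
  · have hT2 : T = insert x (insert y R) := by
      ext z; simp only [hR, mem_insert, mem_erase]
      by_cases z = x <;> by_cases z = y <;> simp_all
    have hx2 : x ∉ insert y R := by simp [hxR, hxy.ne]
    have h3 : nbrs G (insert y R) x = 1 + nbrs G R x := by
      unfold nbrs; rw [sum_insert hyR, if_pos hxy]
    rw [hT2, dsum_insert G hx2, dsum_insert G hyR, card_insert_of_notMem hx2,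
      card_insert_of_notMem hyR] at hT
    omega
  · have hT2 : T = insert x R := by
      ext z; simp only [hR, mem_insert, mem_erase]
      by_cases z = x <;> by_cases z = y <;> simp_all
    rw [hT2, dsum_insert G hxR, card_insert_of_notMem hxR] at hT
    omega
  · have hT2 : T = insert y R := by
      ext z; simp only [hR, mem_insert, mem_erase]
      by_cases z = x <;> by_cases z = y <;> simp_all
    rw [hT2, dsum_insert G hyR, card_insert_of_notMem hyR] at hT
    omega
  · have hT2 : T = R := by
      ext z; simp only [hR, mem_erase]
      by_cases z = x <;> by_cases z = y <;> simp_all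
    rw [hT2] at hT
    omega

end Obs

/-! ### The weighted core of an obstruction -/

section Core

open scoped Classical

variable {V : Type} [Fintype V] {G : SimpleGraph V}

omit [Fintype V] in
lemma nbrs_mono {S T : Finset V} (h : S ⊆ T) (u : V) : nbrs G S u ≤ nbrs G T u :=
  sum_le_sum_of_subset h

omit [Fintype V] in
lemma nbrs_eq_card (S : Finset V) (u : V) : nbrs G S u = #{z ∈ S | G.Adj u z} :=
  (card_filter _ _).symm

lemma Obs.two_le_nbrs (h : ObsApexPseudoforest G) (u : V) : 2 ≤ nbrs G univ u := by
  by_contra! hu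
  obtain ⟨v, hvu, hv⟩ := Obs.delete_vertex h u
  obtain ⟨S, hvS, hS⟩ := Obs.nonapex h v
  by_cases huS : u ∈ S
  · have h1 := hv (S.erase u) (by simp [hvS]) (by simp)
    have h2 := dsum_insert G (notMem_erase u S)
    have h3 := nbrs_mono (G := G) (subset_univ (S.erase u)) u
    have h4 := card_erase_add_one huS
    rw [insert_erase huS] at h2
    omega
  · have := hv S hvS huS
    omega

omit [Fintype V] in
lemma nbrs_eq_of_pair {t a b : V} (hab : a ≠ b) (ht : ∀ z, G.Adj t z ↔ z = a ∨ z = b)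
    (S : Finset V) :
    nbrs G S t = (if a ∈ S then 1 else 0) + if b ∈ S then 1 else 0 := by
  have h : ∀ z, (if G.Adj t z then 1 else 0) = (if a = z then 1 else 0) + if b = z then 1 else 0 := by
    intro z
    by_cases h1 : a = z
    · subst h1; simp [ht, hab.symm]
    · by_cases h2 : b = z
      · subst h2; simp [ht, hab]
      · simp [ht, h1, h2, Ne.symm h1, Ne.symm h2]
  unfold nbrs
  rw [sum_congr rfl fun z _ => h z, sum_add_distrib]
  simp

lemma Obs.exists_pair (h : ObsApexPseudoforest G) {t : V} (ht : nbrs G univ t = 2) :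
    ∃ a b, a ≠ b ∧ (∀ z, G.Adj t z ↔ z = a ∨ z = b) ∧ G.Adj a b := by
  rw [nbrs_eq_card, card_eq_two] at ht
  obtain ⟨a, b, hab, hN⟩ := ht
  have hN' : ∀ z, G.Adj t z ↔ z = a ∨ z = b := fun z => by
    have := congr(z ∈ $hN)
    simpa using this
  refine ⟨a, b, hab, hN', ?_⟩
  by_contra hadj
  have hta := (hN' a).2 (.inl rfl)
  obtain ⟨S, haS, hS⟩ := Obs.nonapex h a
  have hc := Obs.contract h hta fun z hz haz => by
    rcases (hN' z).1 hz with rfl | rfl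
    · exact haz.ne rfl
    · exact hadj haz
  by_cases htS : t ∈ S
  · have h1 := hc (S.erase t) (by simp) (by simp [haS])
    have h2 := dsum_insert G (notMem_erase t S)
    have h3 := nbrs_eq_of_pair hab hN' (S.erase t)
    have h4 := card_erase_add_one htS
    rw [insert_erase htS] at h2
    rw [if_neg (by simp [haS])] at h3
    split_ifs at h3 <;> omega
  · have := hc S htS haS
    omega

variable (G) in
/-- The vertices of degree at least three. -/
noncomputable def core : Finset V := {v | 3 ≤ nbrs G univ v}

variable (G) in
/-- The vertices of degree two. -/
noncomputable def thin : Finset V := {v | nbrs G univ v = 2}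

variable (G) in
/-- The neighbours of `t` in the core. -/
noncomputable def feet (t : V) : Finset V := {z ∈ core G | G.Adj t z}

variable (G) in
/-- The vertices of degree two with core neighbours `x` and `y`. -/
noncomputable def thinAt (x y : V) : Finset V := {t ∈ thin G | feet G t = {x, y}}

variable (G) in
/-- The weight of a pair of core vertices. -/
noncomputable def wt (x y : V) : ℕ := (if G.Adj x y then 1 else 0) + #(thinAt G x y)

variable (G) in
/-- The total weight in a set of core vertices. -/
noncomputable def wsum (S : Finset V) : ℕ := ∑ x ∈ S, ∑ y ∈ S, wt G x y

variable (G) in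
/-- A set of core vertices with all the degree two vertices attached to it. -/
noncomputable def cl (S : Finset V) : Finset V :=
  S ∪ {t ∈ thin G | (feet G t).Nonempty ∧ feet G t ⊆ S}

lemma mem_core {v : V} : v ∈ core G ↔ 3 ≤ nbrs G univ v := by simp [core]

lemma mem_thin {v : V} : v ∈ thin G ↔ nbrs G univ v = 2 := by simp [thin]

lemma mem_feet {t z : V} : z ∈ feet G t ↔ z ∈ core G ∧ G.Adj t z := by simp [feet]

lemma mem_thinAt {t x y : V} : t ∈ thinAt G x y ↔ t ∈ thin G ∧ feet G t = {x, y} := by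
  simp [thinAt]

lemma thin_notMem_core {t : V} (ht : t ∈ thin G) : t ∉ core G := by
  rw [mem_thin] at ht; rw [mem_core]; omega

lemma Obs.mem_core_or_thin (h : ObsApexPseudoforest G) (v : V) : v ∈ core G ∨ v ∈ thin G := by
  have := Obs.two_le_nbrs h v
  rw [mem_core, mem_thin]; omega

lemma thinAt_comm (x y : V) : thinAt G x y = thinAt G y x := by
  unfold thinAt; rw [pair_comm]

lemma wt_comm (x y : V) : wt G x y = wt G y x := by
  unfold wt; rw [thinAt_comm, if_congr (G.adj_comm x y) rfl rfl]

/-- The contribution of `t` to the total weight of `S`. -/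
noncomputable def share (G : SimpleGraph V) (S : Finset V) (t : V) : ℕ :=
  ∑ x ∈ S, ∑ y ∈ S, if feet G t = {x, y} then 1 else 0

lemma wsum_eq (S : Finset V) : wsum G S = dsum G S + ∑ t ∈ thin G, share G S t := by
  unfold wsum wt dsum share
  simp only [sum_add_distrib]
  congr 1
  simp only [thinAt, card_filter]
  symm
  rw [sum_comm]
  exact sum_congr rfl fun x _ => sum_comm

lemma share_pair {S : Finset V} {t a b : V} (hab : a ≠ b) (ht : feet G t = {a, b}) :
    share G S t = if a ∈ S ∧ b ∈ S then 2 else 0 := by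
  have h : ∀ x y, (if feet G t = {x, y} then 1 else 0) =
      (if a = x then (if b = y then 1 else 0) else 0) +
        if b = x then (if a = y then 1 else 0) else 0 := by
    intro x y
    have hiff : feet G t = {x, y} ↔ a = x ∧ b = y ∨ b = x ∧ a = y := by
      rw [ht]
      constructor
      · intro h
        have h1 := congr(a ∈ $h)
        have h2 := congr(b ∈ $h)
        simp at h1 h2
        rcases h1 with rfl | rfl <;> rcases h2 with rfl | rfl <;> simp_all
      · rintro (⟨rfl, rfl⟩ | ⟨rfl, rfl⟩)
        · rfl
        · exact pair_comm _ _
    by_cases h1 : a = x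
    · subst h1
      by_cases h2 : b = y
      · subst h2; simp [hiff, hab.symm]
      · simp [hiff, h2, hab.symm]
    · by_cases h2 : b = x <;> simp [hiff, h1, h2]
  unfold share
  simp only [h, sum_add_distrib]
  by_cases ha : a ∈ S <;> by_cases hb : b ∈ S <;> simp [sum_ite_irrel, ha, hb]

lemma share_single {S : Finset V} {t a : V} (ht : feet G t = {a}) :
    share G S t = if a ∈ S then 1 else 0 := by
  have h : ∀ x y, (if feet G t = {x, y} then 1 else 0) =
      (if a = x then (if a = y then 1 else 0) else 0) := by
    intro x y
    have hiff : feet G t = {x, y} ↔ a = x ∧ a = y := by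
      rw [ht]
      constructor
      · intro h
        have h1 := congr(x ∈ $h)
        have h2 := congr(y ∈ $h)
        simp at h1 h2
        exact ⟨h1.symm, h2.symm⟩
      · rintro ⟨rfl, rfl⟩
        simp
    by_cases h1 : a = x <;> by_cases h2 : a = y <;> simp [hiff, h1, h2]
  unfold share
  simp only [h]
  by_cases ha : a ∈ S <;> simp [sum_ite_irrel, ha]

lemma share_empty {S : Finset V} {t : V} (ht : feet G t = ∅) : share G S t = 0 := by
  refine sum_eq_zero fun x _ => sum_eq_zero fun y _ => if_neg ?_
  rw [ht]
  exact (insert_ne_empty _ _).symm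

/-- The three ways in which a vertex of degree two is attached to the core. -/
lemma Obs.thin_cases (h : ObsApexPseudoforest G) {t : V} (ht : t ∈ thin G) :
    ∃ a b, a ≠ b ∧ (∀ z, G.Adj t z ↔ z = a ∨ z = b) ∧ G.Adj a b ∧
      ((a ∈ core G ∧ b ∈ core G ∧ feet G t = {a, b}) ∨
        (a ∈ core G ∧ b ∈ thin G ∧ feet G t = {a} ∧ feet G b = {a}) ∨
        (a ∈ thin G ∧ b ∈ thin G ∧ feet G t = ∅)) := by
  have key : ∀ a b, a ≠ b → (∀ z, G.Adj t z ↔ z = a ∨ z = b) → G.Adj a b → a ∈ core G →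
      b ∈ thin G → feet G t = {a} ∧ feet G b = {a} := by
    intro a b hab hN hadj ha hb
    have hb' := thin_notMem_core hb
    constructor
    · ext z
      rw [mem_feet, hN, mem_singleton]
      constructor
      · rintro ⟨hz, rfl | rfl⟩
        · rfl
        · exact absurd hz hb'
      · rintro rfl
        exact ⟨ha, .inl rfl⟩
    · obtain ⟨c, d, hcd, hN', -⟩ := Obs.exists_pair h (mem_thin.1 hb)
      have h1 := (hN' a).1 hadj.symm
      have h2 := (hN' t).1 ((hN b).2 (.inr rfl)).symm
      have hta : t ≠ a := fun hta => thin_notMem_core ht (hta ▸ ha)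
      have ht' := thin_notMem_core ht
      ext z
      rw [mem_feet, hN', mem_singleton]
      constructor
      · rintro ⟨hz, hz2⟩
        have hzt : z ≠ t := fun hzt => ht' (hzt ▸ hz)
        grind
      · rintro rfl
        exact ⟨ha, h1⟩
  obtain ⟨a, b, hab, hN, hadj⟩ := Obs.exists_pair h (mem_thin.1 ht)
  rcases Obs.mem_core_or_thin h a with ha | ha <;> rcases Obs.mem_core_or_thin h b with hb | hb
  · refine ⟨a, b, hab, hN, hadj, .inl ⟨ha, hb, ?_⟩⟩
    ext z
    rw [mem_feet, hN, mem_insert, mem_singleton]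
    constructor
    · exact And.right
    · rintro (rfl | rfl)
      · exact ⟨ha, .inl rfl⟩
      · exact ⟨hb, .inr rfl⟩
  · exact ⟨a, b, hab, hN, hadj, .inr (.inl ⟨ha, hb, key a b hab hN hadj ha hb⟩)⟩
  · have hN' : ∀ z, G.Adj t z ↔ z = b ∨ z = a := fun z => (hN z).trans or_comm
    exact ⟨b, a, hab.symm, hN', hadj.symm,
      .inr (.inl ⟨hb, ha, key b a hab.symm hN' hadj.symm hb ha⟩)⟩
  · refine ⟨a, b, hab, hN, hadj, .inr (.inr ⟨ha, hb, ?_⟩)⟩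
    ext z
    rw [mem_feet, hN]
    constructor
    · rintro ⟨hz, rfl | rfl⟩
      · exact absurd hz (thin_notMem_core ha)
      · exact absurd hz (thin_notMem_core hb)
    · simp

omit [Fintype V] in
lemma dsum_union {A B : Finset V} (hAB : Disjoint A B) :
    dsum G (A ∪ B) = dsum G A + ∑ t ∈ B, (2 * nbrs G A t + nbrs G B t) := by
  unfold dsum nbrs
  rw [sum_union hAB]
  simp only [sum_union hAB, sum_add_distrib, ← mul_sum]
  rw [sum_comm (s := A) (t := B)]
  have : ∀ a b, (if G.Adj a b then 1 else 0) = (if G.Adj b a then 1 else 0) :=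
    fun a b => if_congr (G.adj_comm a b) rfl rfl
  rw [sum_congr rfl fun b _ => sum_congr rfl fun a _ => this a b]
  ring

lemma core_disjoint_thin : Disjoint (core G) (thin G) :=
  disjoint_right.2 fun _ => thin_notMem_core

lemma Obs.attach_le (h : ObsApexPseudoforest G) {A B : Finset V} (hA : A ⊆ core G)
    (hB : B ⊆ thin G) {t : V} (ht : t ∈ thin G) :
    2 * nbrs G A t + nbrs G B t ≤ 2 + share G A t := by
  obtain ⟨a, b, hab, hN, hadj, hc⟩ := Obs.thin_cases h ht
  rw [nbrs_eq_of_pair hab hN, nbrs_eq_of_pair hab hN]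
  have hAB : ∀ {z}, z ∈ core G → z ∉ B := fun hz hzB => thin_notMem_core (hB hzB) hz
  have hBA : ∀ {z}, z ∈ thin G → z ∉ A := fun hz hzA => thin_notMem_core hz (hA hzA)
  obtain ⟨ha, hb, hf⟩ | ⟨ha, hb, hf, -⟩ | ⟨ha, hb, hf⟩ := hc
  · rw [share_pair hab hf, if_neg (hAB ha), if_neg (hAB hb)]
    split_ifs <;> simp_all
  · rw [share_single hf, if_neg (hAB ha), if_neg (hBA hb)]
    split_ifs <;> simp
  · rw [if_neg (hBA ha), if_neg (hBA hb)]
    split_ifs <;> omega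

lemma Obs.dsum_le (h : ObsApexPseudoforest G) {A B : Finset V} (hA : A ⊆ core G)
    (hB : B ⊆ thin G) : dsum G (A ∪ B) ≤ wsum G A + 2 * #B := by
  rw [dsum_union (disjoint_of_subset_left hA (disjoint_of_subset_right hB core_disjoint_thin)),
    wsum_eq]
  have h1 : ∑ t ∈ B, (2 * nbrs G A t + nbrs G B t) ≤ ∑ t ∈ B, (2 + share G A t) :=
    sum_le_sum fun t ht => Obs.attach_le h hA hB (hB ht)
  have h2 : ∑ t ∈ B, share G A t ≤ ∑ t ∈ thin G, share G A t := sum_le_sum_of_subset hB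
  rw [sum_add_distrib (f := fun _ => 2), sum_const, smul_eq_mul] at h1
  omega

lemma mem_cl {S : Finset V} {v : V} :
    v ∈ cl G S ↔ v ∈ S ∨ v ∈ thin G ∧ (feet G v).Nonempty ∧ feet G v ⊆ S := by
  simp [cl]

lemma Obs.dsum_cl (h : ObsApexPseudoforest G) {A : Finset V} (hA : A ⊆ core G) :
    dsum G (cl G A) + 2 * #A = wsum G A + 2 * #(cl G A) := by
  set B := {t ∈ thin G | (feet G t).Nonempty ∧ feet G t ⊆ A} with hB
  have hBD : B ⊆ thin G := filter_subset _ _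
  have hdis := disjoint_of_subset_left hA (disjoint_of_subset_right hBD core_disjoint_thin)
  have hcl : cl G A = A ∪ B := rfl
  have hAB : ∀ {z}, z ∈ core G → z ∉ B := fun hz hzB => thin_notMem_core (hBD hzB) hz
  have hBA : ∀ {z}, z ∈ thin G → z ∉ A := fun hz hzA => thin_notMem_core hz (hA hzA)
  rw [hcl, dsum_union hdis, wsum_eq, card_union_of_disjoint hdis]
  have h1 : ∑ t ∈ B, (2 * nbrs G A t + nbrs G B t) = ∑ t ∈ B, (2 + share G A t) := by
    refine sum_congr rfl fun t ht => ?_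
    obtain ⟨htD, hne, hsub⟩ := mem_filter.1 ht
    obtain ⟨a, b, hab, hN, hadj, hc⟩ := Obs.thin_cases h htD
    rw [nbrs_eq_of_pair hab hN, nbrs_eq_of_pair hab hN]
    obtain ⟨ha, hb, hf⟩ | ⟨ha, hb, hf, hfb⟩ | ⟨ha, hb, hf⟩ := hc
    · rw [hf] at hsub
      have haA : a ∈ A := hsub (by simp)
      have hbA : b ∈ A := hsub (by simp)
      rw [share_pair hab hf, if_neg (hAB ha), if_neg (hAB hb)]
      simp [haA, hbA]
    · rw [hf] at hsub
      have haA : a ∈ A := hsub (by simp)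
      have hbB : b ∈ B := by
        rw [hB, mem_filter, hfb]
        exact ⟨hb, by simp, by simpa using haA⟩
      rw [share_single hf, if_neg (hAB ha), if_neg (hBA hb)]
      simp [haA, hbB]
    · simp [hf] at hne
  have h2 : ∑ t ∈ B, share G A t = ∑ t ∈ thin G, share G A t := by
    refine sum_subset hBD fun t ht htB => ?_
    obtain ⟨a, b, hab, hN, hadj, hc⟩ := Obs.thin_cases h ht
    have htB' : (feet G t).Nonempty → ¬ feet G t ⊆ A := fun h1 h2 =>
      htB (mem_filter.2 ⟨ht, h1, h2⟩)
    obtain ⟨ha, hb, hf⟩ | ⟨ha, hb, hf, hfb⟩ | ⟨ha, hb, hf⟩ := hc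
    · rw [share_pair hab hf, if_neg]
      rintro ⟨h1, h2⟩
      refine htB' (by simp [hf]) ?_
      rw [hf]
      simp [insert_subset_iff, h1, h2]
    · rw [share_single hf, if_neg]
      intro h1
      exact htB' (by simp [hf]) (by simpa [hf] using h1)
    · exact share_empty hf
  rw [h1, sum_add_distrib, sum_const, smul_eq_mul, h2]
  ring

lemma Obs.core_nonapex (h : ObsApexPseudoforest G) (v : V) :
    ∃ S ⊆ core G, v ∉ S ∧ 2 * #S < wsum G S := by
  obtain ⟨S, hv, hS⟩ := Obs.nonapex h v
  have hdis : Disjoint (S ∩ core G) (S ∩ thin G) :=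
    disjoint_of_subset_left inter_subset_right
      (disjoint_of_subset_right inter_subset_right core_disjoint_thin)
  have hun : S ∩ core G ∪ S ∩ thin G = S := by
    ext z
    have := Obs.mem_core_or_thin h z
    simp only [mem_union, mem_inter]
    tauto
  refine ⟨S ∩ core G, inter_subset_right, by simp [hv], ?_⟩
  have h1 := Obs.dsum_le h (A := S ∩ core G) (B := S ∩ thin G) inter_subset_right inter_subset_right
  have h2 := card_union_of_disjoint hdis
  rw [hun] at h1 h2
  omega

lemma Obs.core_nonempty (h : ObsApexPseudoforest G) : (core G).Nonempty := by
  obtain ⟨v⟩ := Obs.nonempty h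
  obtain ⟨S, hSC, -, hS⟩ := Obs.core_nonapex h v
  rw [nonempty_iff_ne_empty]
  intro hC
  rw [hC, subset_empty] at hSC
  simp [hSC, wsum] at hS

lemma Obs.thinAt_adj (h : ObsApexPseudoforest G) {x y t : V} (hxy : x ≠ y)
    (ht : t ∈ thinAt G x y) : G.Adj x y ∧ ∀ z, G.Adj t z ↔ z = x ∨ z = y := by
  obtain ⟨ht, hf⟩ := mem_thinAt.1 ht
  obtain ⟨a, b, hab, hN, hadj, hc⟩ := Obs.thin_cases h ht
  have hx : G.Adj t x := (mem_feet.1 (hf ▸ mem_insert_self x {y})).2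
  have hy : G.Adj t y := (mem_feet.1 (hf ▸ mem_insert_of_mem (mem_singleton_self y))).2
  rcases (hN x).1 hx with rfl | rfl <;> rcases (hN y).1 hy with rfl | rfl
  · exact absurd rfl hxy
  · exact ⟨hadj, hN⟩
  · exact ⟨hadj.symm, fun z => (hN z).trans or_comm⟩
  · exact absurd rfl hxy

lemma Obs.adj_of_wt (h : ObsApexPseudoforest G) {x y : V} (hxy : x ≠ y) (hw : 1 ≤ wt G x y) :
    G.Adj x y := by
  by_contra hadj
  unfold wt at hw
  rw [if_neg hadj, zero_add, one_le_card] at hw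
  obtain ⟨t, ht⟩ := hw
  exact hadj (Obs.thinAt_adj h hxy ht).1

lemma notMem_cl {S : Finset V} {v : V} (hv : v ∈ core G) (hvS : v ∉ S) : v ∉ cl G S := by
  rw [mem_cl]
  rintro (h | h)
  · exact hvS h
  · exact thin_notMem_core h.1 hv

lemma Obs.core_delete (h : ObsApexPseudoforest G) {x y : V} (hx : x ∈ core G) (hy : y ∈ core G)
    (hw : 1 ≤ wt G x y) :
    ∃ v ∈ core G, ∀ S ⊆ core G, v ∉ S → wsum G S ≤ 2 * #S + if x ∈ S ∧ y ∈ S then 2 else 0 := by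
  obtain ⟨x', y', hadj, hcl⟩ : ∃ x' y', G.Adj x' y' ∧
      ∀ S ⊆ core G, x' ∈ cl G S ∧ y' ∈ cl G S → x ∈ S ∧ y ∈ S := by
    by_cases hadj : G.Adj x y
    · refine ⟨x, y, hadj, fun S _ hS => ?_⟩
      by_contra hcon
      rcases not_and_or.1 hcon with h1 | h1
      · exact notMem_cl hx h1 hS.1
      · exact notMem_cl hy h1 hS.2
    · unfold wt at hw
      rw [if_neg hadj, zero_add, one_le_card] at hw
      obtain ⟨t, ht⟩ := hw
      obtain ⟨ht, hf⟩ := mem_thinAt.1 ht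
      refine ⟨t, x, (mem_feet.1 (hf ▸ mem_insert_self x {y})).2, fun S hSC hS => ?_⟩
      rcases mem_cl.1 hS.1 with h1 | h1
      · exact absurd (hSC h1) (thin_notMem_core ht)
      · rw [hf] at h1
        exact ⟨h1.2.2 (by simp), h1.2.2 (by simp)⟩
  obtain ⟨v, hv⟩ := Obs.delete_edge h hadj
  obtain ⟨v', hv'C, hv'⟩ : ∃ v' ∈ core G, ∀ S ⊆ core G, v' ∉ S → v ∉ cl G S := by
    rcases Obs.mem_core_or_thin h v with hvC | hvD
    · exact ⟨v, hvC, fun S _ hS => notMem_cl hvC hS⟩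
    · by_cases hf : (feet G v).Nonempty
      · obtain ⟨z, hz⟩ := hf
        refine ⟨z, (mem_feet.1 hz).1, fun S hSC hzS hvS => ?_⟩
        rcases mem_cl.1 hvS with h1 | h1
        · exact thin_notMem_core hvD (hSC h1)
        · exact hzS (h1.2.2 hz)
      · obtain ⟨z, hz⟩ := Obs.core_nonempty h
        refine ⟨z, hz, fun S hSC _ hvS => ?_⟩
        rcases mem_cl.1 hvS with h1 | h1
        · exact thin_notMem_core hvD (hSC h1)
        · exact hf h1.2.1
  refine ⟨v', hv'C, fun S hSC hvS => ?_⟩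
  have h1 := hv (cl G S) (hv' S hSC hvS)
  have h2 := Obs.dsum_cl h hSC
  have h3 := hcl S hSC
  by_cases h4 : x ∈ S ∧ y ∈ S
  · rw [if_pos h4]
    split_ifs at h1 <;> omega
  · rw [if_neg fun h5 => h4 (h3 h5)] at h1
    omega

lemma Obs.core_contract (h : ObsApexPseudoforest G) {x y : V} (hx : x ∈ core G) (hy : y ∈ core G)
    (hxy : x ≠ y) (hw : wt G x y = 1)
    (hz : ∀ z ∈ core G, z ≠ x → z ≠ y → wt G x z = 0 ∨ wt G y z = 0) :
    ∀ S ⊆ core G, x ∉ S → y ∉ S → wsum G S ≤ 2 * #S := by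
  intro S hSC hxS hyS
  have hadj := Obs.adj_of_wt h hxy hw.ge
  have hemp : thinAt G x y = ∅ := by
    unfold wt at hw
    rw [if_pos hadj] at hw
    exact card_eq_zero.1 (by omega)
  have h1 := Obs.contract h hadj (fun z hxz hyz => by
    rcases Obs.mem_core_or_thin h z with hzC | hzD
    · rcases hz z hzC hxz.ne' hyz.ne' with h0 | h0
      · simp [wt, hxz] at h0
      · simp [wt, hyz] at h0
    · refine absurd (mem_thinAt.2 ⟨hzD, ?_⟩) (hemp ▸ notMem_empty z)
      obtain ⟨a, b, hab, hN, -, hc⟩ := Obs.thin_cases h hzD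
      have hxf : x ∈ feet G z := mem_feet.2 ⟨hx, hxz.symm⟩
      have hyf : y ∈ feet G z := mem_feet.2 ⟨hy, hyz.symm⟩
      obtain ⟨-, -, hf⟩ | ⟨-, -, hf, -⟩ | ⟨-, -, hf⟩ := hc
      · rw [hf] at hxf hyf ⊢
        simp only [mem_insert, mem_singleton] at hxf hyf
        rcases hxf with rfl | rfl <;> rcases hyf with rfl | rfl
        · exact absurd rfl hxy
        · rfl
        · exact pair_comm _ _
        · exact absurd rfl hxy
      · rw [hf, mem_singleton] at hxf hyf
        exact absurd (hxf.trans hyf.symm) hxy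
      · simp [hf] at hxf) (cl G S) (notMem_cl hx hxS) (notMem_cl hy hyS)
  have h2 := Obs.dsum_cl h hSC
  omega

lemma Obs.core_degree (h : ObsApexPseudoforest G) {x : V} (hx : x ∈ core G) :
    3 ≤ ∑ y ∈ core G, wt G x y := by
  refine (mem_core.1 hx).trans ?_
  have huniv : (univ : Finset V) = core G ∪ thin G := by
    ext z
    have := Obs.mem_core_or_thin h z
    simpa using this
  unfold wt nbrs
  rw [huniv, sum_union core_disjoint_thin, sum_add_distrib]
  refine add_le_add le_rfl ?_
  simp only [thinAt, card_filter]
  rw [sum_comm]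
  refine sum_le_sum fun t ht => ?_
  by_cases hxt : G.Adj x t
  swap
  · simp [hxt]
  rw [if_pos hxt]
  have hxf : x ∈ feet G t := mem_feet.2 ⟨hx, hxt.symm⟩
  have : ∃ y ∈ core G, feet G t = {x, y} := by
    obtain ⟨a, b, hab, hN, -, hc⟩ := Obs.thin_cases h ht
    obtain ⟨ha, hb, hf⟩ | ⟨-, -, hf, -⟩ | ⟨-, -, hf⟩ := hc
    · rw [hf, mem_insert, mem_singleton] at hxf
      rcases hxf with rfl | rfl
      · exact ⟨b, hb, hf⟩
      · exact ⟨a, ha, hf.trans (pair_comm _ _)⟩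
    · rw [hf, mem_singleton] at hxf
      subst hxf
      exact ⟨x, hx, by simp [hf]⟩
    · simp [hf] at hxf
  obtain ⟨y, hy, hf⟩ := this
  refine le_trans ?_ (single_le_sum (fun _ _ => Nat.zero_le _) hy)
  rw [if_pos hf]

omit [Fintype V] in
lemma exists_mate_enumeration [Nonempty V] {P : Finset V}
    (hP : ∀ t ∈ P, ∃ m ∈ P, G.Adj t m ∧ ∀ z ∈ P, G.Adj t z → z = m) :
    ∃ (k : ℕ) (g : ℕ → V), #P = 2 * k ∧ (∀ i < 2 * k, g i ∈ P) ∧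
      (∀ i < 2 * k, ∀ j < 2 * k, g i = g j → i = j) ∧
      ∀ l < k, G.Adj (g (2 * l)) (g (2 * l + 1)) := by
  induction P using Finset.strongInduction with
  | H P ih =>
  rcases P.eq_empty_or_nonempty with rfl | ⟨t, ht⟩
  · exact ⟨0, fun _ => Classical.arbitrary V, by simp⟩
  · obtain ⟨m, hm, htm, huniq⟩ := hP t ht
    have hmt : m ≠ t := htm.ne'
    obtain ⟨k, g, hk, hg, hinj, hadj⟩ := ih ((P.erase t).erase m)
      ((erase_subset _ _).trans_ssubset (erase_ssubset ht)) (by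
        intro s hs
        simp only [mem_erase] at hs
        obtain ⟨hsm, hst, hsP⟩ := hs
        obtain ⟨m', hm', hsm', hu⟩ := hP s hsP
        refine ⟨m', ?_, hsm', fun z hz => hu z (mem_of_mem_erase (mem_of_mem_erase hz))⟩
        simp only [mem_erase]
        refine ⟨?_, ?_, hm'⟩
        · rintro rfl
          obtain ⟨m2, -, -, hu2⟩ := hP m' hm
          exact hst ((hu2 s hsP hsm'.symm).trans (hu2 t ht htm.symm).symm)
        · rintro rfl
          exact hsm (huniq s hsP hsm'.symm))
    refine ⟨k + 1, fun i => if i < 2 * k then g i else if i = 2 * k then t else m, ?_, ?_, ?_, ?_⟩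
    · have h1 := card_erase_add_one ht
      have h2 := card_erase_add_one (mem_erase.2 ⟨hmt, hm⟩)
      omega
    · intro i hi
      dsimp only
      split_ifs with h1 h2
      · exact mem_of_mem_erase (mem_of_mem_erase (hg i h1))
      · exact ht
      · exact hm
    · intro i hi j hj
      have key : ∀ i < 2 * k, g i ≠ t ∧ g i ≠ m := fun i hi => by
        have := hg i hi
        simp only [mem_erase] at this
        exact ⟨this.2.1, this.1⟩
      dsimp only
      split_ifs with h1 h2 h3 h4 h5 h6 h7 h8 <;> intro he
      · exact hinj i h1 j h2 he
      · exact absurd he (key i h1).1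
      · exact absurd he (key i h1).2
      · exact absurd he.symm (key j h5).1
      · omega
      · exact absurd he hmt.symm
      · exact absurd he.symm (key j h7).2
      · exact absurd he hmt
      · omega
    · intro l hl
      dsimp only
      rcases Nat.lt_succ_iff_lt_or_eq.1 hl with h1 | rfl
      · rw [if_pos (by omega), if_pos (by omega)]
        exact hadj l h1
      · rw [if_neg (by omega), if_pos rfl, if_neg (by omega), if_neg (by omega)]
        exact htm

lemma Obs.thinAt_self (h : ObsApexPseudoforest G) (x : V) :
    ∃ (k : ℕ) (g : ℕ → V), wt G x x = 2 * k ∧ (∀ i < 2 * k, g i ∈ thinAt G x x) ∧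
      (∀ i < 2 * k, ∀ j < 2 * k, g i = g j → i = j) ∧
      ∀ l < k, G.Adj (g (2 * l)) (g (2 * l + 1)) := by
  have hw : wt G x x = #(thinAt G x x) := by simp [wt]
  have := Obs.nonempty h
  rw [hw]
  refine exists_mate_enumeration fun t ht => ?_
  obtain ⟨ht, hf⟩ := mem_thinAt.1 ht
  rw [pair_eq_singleton] at hf
  obtain ⟨a, b, hab, hN, -, hc⟩ := Obs.thin_cases h ht
  obtain ⟨ha, hb, hf'⟩ | ⟨ha, hb, hf', hfb⟩ | ⟨-, -, hf'⟩ := hc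
  · have := card_pair hab
    rw [← hf', hf] at this
    simp at this
  · have hax : a = x := by
      rw [hf, singleton_inj] at hf'; exact hf'.symm
    subst hax
    refine ⟨b, mem_thinAt.2 ⟨hb, by simp [hfb]⟩, (hN b).2 (.inr rfl), fun z hz htz => ?_⟩
    rcases (hN z).1 htz with rfl | rfl
    · exact absurd ha (thin_notMem_core (mem_thinAt.1 hz).1)
    · rfl
  · simp [hf] at hf'

end Core

/-! ### Indexing the core -/

lemma two_mul_val {w W : ℕ → ℕ → ℕ} (hs : ∀ i j, W i j = W j i) (hd : ∀ i, W i i = 2 * w i i)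
    (ho : ∀ i j, i ≠ j → W i j = w i j) (S : Finset ℕ) :
    2 * val w S = ∑ i ∈ S, ∑ j ∈ S, W i j := by
  induction S using Finset.induction_on_max with
  | empty => simp [val]
  | insert k S hk ih =>
    have hkS : k ∉ S := fun h => (hk k h).false
    have h1 : ∑ j ∈ S, w k j = ∑ j ∈ S, W k j :=
      sum_congr rfl fun j hj => (ho k j (hk j hj).ne').symm
    have h2 : ∑ j ∈ S, W j k = ∑ j ∈ S, W k j := sum_congr rfl fun j _ => hs j k
    rw [val_insert w (fun x hx => mem_range.2 (hk x hx)), sum_insert hkS]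
    simp only [sum_insert hkS, sum_add_distrib]
    rw [h2, h1, hd, ← ih]
    ring

section Sum

variable {ι : Type*} [DecidableEq ι]

lemma sum_sum_erase {C : Finset ι} {W : ι → ι → ℕ} (hs : ∀ i j, W i j = W j i) {v : ι}
    (hv : v ∈ C) :
    ∑ i ∈ C, ∑ j ∈ C, W i j + W v v = ∑ i ∈ C.erase v, ∑ j ∈ C.erase v, W i j +
      2 * ∑ j ∈ C, W v j := by
  have h1 : ∀ i, ∑ j ∈ C, W i j = W i v + ∑ j ∈ C.erase v, W i j := fun i =>
    (add_sum_erase C (W i) hv).symm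
  rw [← add_sum_erase C (fun i => ∑ j ∈ C, W i j) hv]
  simp only [h1, sum_add_distrib]
  rw [sum_congr rfl fun i _ => hs i v]
  ring

end Sum

lemma exists_sorted_list {α : Type*} (R : Finset α) (f : α → ℕ) :
    ∃ L : List α, L.Nodup ∧ (∀ z, z ∈ L ↔ z ∈ R) ∧ L.Pairwise fun a b => f b ≤ f a := by
  classical
  let r : α → α → Prop := fun a b => f b ≤ f a
  have : Std.Total r := ⟨fun a b => le_total (f b) (f a)⟩
  have : IsTrans α r := ⟨fun a b c h1 h2 => le_trans h2 h1⟩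
  refine ⟨R.toList.insertionSort r, ?_, fun z => ?_, List.pairwise_insertionSort r _⟩
  · exact (List.perm_insertionSort r _).nodup_iff.2 R.nodup_toList
  · rw [(List.perm_insertionSort r _).mem_iff, mem_toList]

section Index

open scoped Classical

variable {V : Type} [Fintype V] {G : SimpleGraph V}

lemma Obs.exists_good (h : ObsApexPseudoforest G) {x y : V} (hx : x ∈ core G) (hy : y ∈ core G)
    (hw : 1 ≤ wt G x y) :
    ∃ v ∈ core G, v ≠ x ∧ v ≠ y ∧ ∀ S ⊆ core G, v ∉ S → wsum G S ≤ 2 * #S + 2 := by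
  obtain ⟨v, hvC, hv⟩ := Obs.core_delete h hx hy hw
  obtain ⟨S, hSC, hvS, hS⟩ := Obs.core_nonapex h v
  have h1 := hv S hSC hvS
  refine ⟨v, hvC, ?_, ?_, fun S hSC hvS => (hv S hSC hvS).trans ?_⟩
  · rintro rfl
    rw [if_neg fun h => hvS h.1] at h1
    omega
  · rintro rfl
    rw [if_neg fun h => hvS h.2] at h1
    omega
  · split_ifs <;> omega

lemma Obs.exists_unit (h : ObsApexPseudoforest G) {x : V} (hx : x ∈ core G) :
    ∃ y ∈ core G, 1 ≤ wt G x y := by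
  by_contra! hcon
  have := Obs.core_degree h hx
  rw [sum_eq_zero fun y hy => Nat.lt_one_iff.1 (hcon y hy)] at this
  omega

lemma Obs.exists_two_good (h : ObsApexPseudoforest G) :
    ∃ v₀ ∈ core G, ∃ v₁ ∈ core G, v₀ ≠ v₁ ∧ wt G v₁ v₁ ≤ wt G v₀ v₀ ∧
      (∀ S ⊆ core G, v₀ ∉ S → wsum G S ≤ 2 * #S + 2) ∧
      ∀ S ⊆ core G, v₁ ∉ S → wsum G S ≤ 2 * #S + 2 := by
  obtain ⟨x, hx⟩ := Obs.core_nonempty h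
  obtain ⟨y, hy, hxy⟩ := Obs.exists_unit h hx
  obtain ⟨a, ha, -, -, hga⟩ := Obs.exists_good h hx hy hxy
  obtain ⟨z, hz, haz⟩ := Obs.exists_unit h ha
  obtain ⟨b, hb, hba, -, hgb⟩ := Obs.exists_good h ha hz haz
  rcases le_total (wt G b b) (wt G a a) with hle | hle
  · exact ⟨a, ha, b, hb, hba.symm, hle, hga, hgb⟩
  · exact ⟨b, hb, a, ha, hba, hle, hgb, hga⟩

lemma Obs.wt_le_three (h : ObsApexPseudoforest G) {x y : V} (hx : x ∈ core G) (hy : y ∈ core G)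
    (hxy : x ≠ y) : wt G x y ≤ 3 := by
  by_cases hw : 1 ≤ wt G x y
  · obtain ⟨v, -, hvx, hvy, hv⟩ := Obs.exists_good h hx hy hw
    have := hv {x, y} (by simp [insert_subset_iff, hx, hy]) (by simp [hvx, hvy])
    simp only [wsum, sum_pair hxy, card_pair hxy, wt_comm y x] at this
    omega
  · omega

lemma Obs.wt_self_le (h : ObsApexPseudoforest G) {x : V} (hx : x ∈ core G) : wt G x x ≤ 4 := by
  by_cases hw : 1 ≤ wt G x x
  · obtain ⟨v, -, hvx, -, hv⟩ := Obs.exists_good h hx hx hw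
    have := hv {x} (by simp [hx]) (by simp [hvx])
    simp only [wsum, sum_singleton, card_singleton] at this
    omega
  · omega

theorem Obs.exists_adm (h : ObsApexPseudoforest G) :
    ∃ (c : ℕ) (w : ℕ → ℕ → ℕ) (p : ℕ → V), Adm w c ∧ (∀ i < c, p i ∈ core G) ∧
      (∀ i < c, ∀ j < c, p i = p j → i = j) ∧
      (∀ i < c, wt G (p i) (p i) = 2 * w i i) ∧
      ∀ i < c, ∀ j < c, i ≠ j → wt G (p i) (p j) = w i j := by
  obtain ⟨v₀, hv₀, v₁, hv₁, hne, hdiag, hg₀, hg₁⟩ := Obs.exists_two_good h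
  obtain ⟨L, hLn, hL, hLs⟩ := exists_sorted_list ((core G).erase v₀ |>.erase v₁)
    fun z => 16 * wt G z v₀ + 4 * wt G z v₁ + wt G z z / 2
  set K := v₀ :: v₁ :: L with hK
  have hKn : K.Nodup := by
    simp only [hK, List.nodup_cons, List.mem_cons, hL, mem_erase]
    exact ⟨by simp [hne], by simp, hLn⟩
  have hKm : ∀ z, z ∈ K ↔ z ∈ core G := fun z => by
    simp only [hK, List.mem_cons, hL, mem_erase]
    constructor
    · rintro (rfl | rfl | ⟨-, -, hz⟩) <;> assumption
    · tauto
  set c := #(core G) with hc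
  have hKc : K.length = c := by
    rw [← List.toFinset_card_of_nodup hKn, hc]
    congr 1
    ext z
    simp [hKm]
  set p : ℕ → V := fun i => K.getD i v₀ with hp
  have hpK : ∀ {i} (hi : i < c), p i = K[i]'(hKc ▸ hi) := fun hi =>
    List.getD_eq_getElem _ _ (hKc ▸ hi)
  have hpC : ∀ {i}, i < c → p i ∈ core G := fun hi => by
    rw [hpK hi, ← hKm]; exact List.getElem_mem _
  have hpinj : ∀ i < c, ∀ j < c, p i = p j → i = j := fun i hi j hj hij => by
    rw [hpK hi, hpK hj] at hij
    exact (hKn.getElem_inj_iff).1 hij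
  have hpsurj : ∀ z ∈ core G, ∃ i < c, p i = z := fun z hz => by
    obtain ⟨i, hi, rfl⟩ := List.getElem_of_mem ((hKm z).2 hz)
    exact ⟨i, hKc ▸ hi, hpK (hKc ▸ hi)⟩
  have hp0 : p 0 = v₀ := rfl
  have hp1 : p 1 = v₁ := rfl
  have hc2 : 2 ≤ c := by rw [← hKc]; simp [hK]
  have heven : ∀ x, wt G x x = 2 * (wt G x x / 2) := fun x => by
    obtain ⟨k, -, hk, -⟩ := Obs.thinAt_self h x
    omega
  set W : ℕ → ℕ → ℕ := fun i j => if i < c ∧ j < c then wt G (p i) (p j) else 0 with hW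
  set w : ℕ → ℕ → ℕ := fun i j => if i = j then W i i / 2 else W i j with hw
  have hWs : ∀ i j, W i j = W j i := fun i j => by
    simp only [hW, wt_comm (p i), and_comm]
  have hWc : ∀ {i j}, i < c → j < c → W i j = wt G (p i) (p j) := fun hi hj => if_pos ⟨hi, hj⟩
  have hws : ∀ i j, w i j = w j i := fun i j => by
    by_cases hij : i = j
    · rw [hij]
    · simp only [hw, if_neg hij, if_neg (Ne.symm hij), hWs i j]
  have hwd : ∀ i, w i i = W i i / 2 := fun i => if_pos rfl
  have hWd : ∀ i, W i i = 2 * w i i := fun i => by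
    rw [hwd]
    by_cases hi : i < c
    · rw [hWc hi hi]; exact heven _
    · simp [hW, hi]
  have hWo : ∀ i j, i ≠ j → W i j = w i j := fun i j hij => (if_neg hij).symm
  have hinjOn : ∀ {S}, S ⊆ range c → Set.InjOn p S := fun hS i hi j hj hij =>
    hpinj i (mem_range.1 (hS hi)) j (mem_range.1 (hS hj)) hij
  have hval : ∀ {S}, S ⊆ range c → 2 * val w S = wsum G (S.image p) := fun {S} hS => by
    rw [two_mul_val hWs hWd hWo, wsum, sum_image (hinjOn hS)]
    refine sum_congr rfl fun i hi => ?_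
    rw [sum_image (hinjOn hS)]
    exact sum_congr rfl fun j hj => hWc (mem_range.1 (hS hi)) (mem_range.1 (hS hj))
  have hcard : ∀ {S}, S ⊆ range c → #(S.image p) = #S := fun hS => card_image_of_injOn (hinjOn hS)
  have hsub : ∀ {S}, S ⊆ range c → S.image p ⊆ core G := fun hS => by
    rw [image_subset_iff]; exact fun i hi => hpC (mem_range.1 (hS hi))
  have hmem : ∀ {S}, S ⊆ range c → ∀ {i}, i < c → (p i ∈ S.image p ↔ i ∈ S) := fun {S} hS {i} hi => by
    rw [mem_image]
    constructor
    · rintro ⟨j, hj, hji⟩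
      rwa [← hpinj j (mem_range.1 (hS hj)) i hi hji]
    · exact fun hi => ⟨i, hi, rfl⟩
  have hdegW : ∀ {i}, i < c → degK w c i = ∑ j ∈ range c, W i j := fun {i} hi => by
    rw [degK, ← add_sum_erase _ _ (mem_range.2 hi), ← add_sum_erase _ (W i) (mem_range.2 hi), hWd,
      sum_congr rfl fun j hj => (hWo i j (mem_erase.1 hj).1.symm).symm]
    ring
  have hdeg : ∀ {i}, i < c → degK w c i = ∑ y ∈ core G, wt G (p i) y := fun {i} hi => by
    have himg : core G = (range c).image p := by
      refine Subset.antisymm (fun z hz => ?_) (hsub Subset.rfl)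
      obtain ⟨j, hj, rfl⟩ := hpsurj z hz
      exact mem_image_of_mem _ (mem_range.2 hj)
    rw [himg, sum_image (hinjOn Subset.rfl), hdegW hi]
    exact sum_congr rfl fun j hj => hWc hi (mem_range.1 hj)
  have hdeg3 : ∀ x < c, 3 ≤ degK w c x := fun x hx => by
    rw [hdeg hx]; exact Obs.core_degree h (hpC hx)
  have hgood : ∀ v < c, (∀ S ⊆ core G, p v ∉ S → wsum G S ≤ 2 * #S + 2) →
      ∀ S ⊆ range c, v ∉ S → val w S ≤ #S + 1 := fun v hv hg S hS hvS => by
    have h1 := hg _ (hsub hS) (by rwa [hmem hS hv])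
    rw [← hval hS, hcard hS] at h1
    omega
  have hgood0 := hgood 0 (by omega) hg₀
  have hgood1 := hgood 1 (by omega) hg₁
  have hbudget : ∑ j ∈ Ico 2 c, degK w c j + w 0 0 + w 1 1 ≤ 2 * c := by
    have hrow : ∀ v < c, (∀ S ⊆ range c, v ∉ S → val w S ≤ #S + 1) →
        ∑ j ∈ range c, degK w c j + 2 * w v v ≤ 2 * c + 2 * degK w c v := fun v hv hg => by
      have h1 := sum_sum_erase hWs (mem_range.2 hv)
      rw [← two_mul_val hWs hWd hWo ((range c).erase v), hWd] at h1
      have h2 := hg _ (erase_subset v (range c)) (notMem_erase _ _)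
      rw [card_erase_of_mem (mem_range.2 hv), card_range] at h2
      rw [sum_congr rfl fun j hj => hdegW (mem_range.1 hj), hdegW hv]
      omega
    have h0 := hrow 0 (by omega) hgood0
    have h1 := hrow 1 (by omega) hgood1
    have h2 : ∑ j ∈ range c, degK w c j = degK w c 0 + degK w c 1 + ∑ j ∈ Ico 2 c, degK w c j := by
      rw [← sum_range_add_sum_Ico _ hc2]
      simp [sum_range_succ]
    omega
  refine ⟨c, w, p, ⟨hc2, ?_, hws, fun i j => ?_, fun i => ?_, hgood0, hgood1, fun v => ?_,
    fun x hx y hy hxy => ?_, fun x hx y hy hne hxy hz S hS hxS hyS => ?_, hdeg3, hbudget, ?_,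
    fun i hi hic => ?_⟩, fun i => hpC, hpinj, fun i hi => ?_, fun i hi j hj hij => ?_⟩
  · have : ∑ j ∈ Ico 2 c, 3 ≤ ∑ j ∈ Ico 2 c, degK w c j :=
      sum_le_sum fun j hj => hdeg3 j (mem_Ico.1 hj).2
    simp only [sum_const, Nat.card_Ico, smul_eq_mul] at this
    omega
  · by_cases hij : i < c ∧ j < c
    · by_cases he : i = j
      · subst he
        rw [hwd, hWc hij.1 hij.1]
        have := Obs.wt_self_le h (hpC hij.1)
        omega
      · rw [← hWo i j he, hWc hij.1 hij.2]
        exact Obs.wt_le_three h (hpC hij.1) (hpC hij.2) fun he' => he (hpinj i hij.1 j hij.2 he')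
    · have h0 : W i j = 0 := if_neg hij
      by_cases he : i = j
      · subst he
        rw [hwd, h0]
        omega
      · rw [← hWo i j he, h0]
        omega
  · rw [hwd]
    by_cases hi : i < c
    · rw [hWc hi hi]
      have := Obs.wt_self_le h (hpC hi)
      omega
    · simp [hW, hi]
  · obtain ⟨T, hTC, hvT, hT⟩ := Obs.core_nonapex h (p v)
    have hTi : {i ∈ range c | p i ∈ T}.image p = T := by
      ext z
      simp only [mem_image, mem_filter, mem_range]
      constructor
      · rintro ⟨i, ⟨-, hi⟩, rfl⟩; exact hi
      · intro hz
        obtain ⟨i, hi, rfl⟩ := hpsurj z (hTC hz)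
        exact ⟨i, ⟨hi, hz⟩, rfl⟩
    refine ⟨{i ∈ range c | p i ∈ T}, filter_subset _ _, by simp [hvT], ?_⟩
    have h1 := hval (filter_subset (fun i => p i ∈ T) (range c))
    have h2 := hcard (filter_subset (fun i => p i ∈ T) (range c))
    rw [hTi] at h1 h2
    omega
  · have hW1 : 1 ≤ wt G (p x) (p y) := by
      rw [← hWc hx hy]
      by_cases h1 : x = y
      · subst h1; rw [hWd]; omega
      · rwa [hWo x y h1]
    obtain ⟨v, hvC, hv⟩ := Obs.core_delete h (hpC hx) (hpC hy) hW1
    obtain ⟨i, hi, rfl⟩ := hpsurj v hvC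
    refine ⟨i, hi, fun S hS hiS => ?_⟩
    have h1 := hv _ (hsub hS) (by rwa [hmem hS hi])
    simp only [hmem hS hx, hmem hS hy, ← hval hS, hcard hS] at h1
    split_ifs at h1 ⊢ <;> omega
  · rw [← hWo x y hne, hWc hx hy] at hxy
    have h1 := Obs.core_contract h (hpC hx) (hpC hy) (fun he => hne (hpinj x hx y hy he)) hxy
      (fun z hzC hzx hzy => by
        obtain ⟨i, hi, rfl⟩ := hpsurj z hzC
        have hix : i ≠ x := fun he => hzx (he ▸ rfl)
        have hiy : i ≠ y := fun he => hzy (he ▸ rfl)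
        have := hz i hi hix hiy
        rwa [← hWo x i hix.symm, ← hWo y i hiy.symm, hWc hx hi, hWc hy hi] at this)
      (S.image p) (hsub hS) (by rwa [hmem hS hx]) (by rwa [hmem hS hy])
    rw [← hval hS, hcard hS] at h1
    omega
  · rw [hwd, hwd, hWc (by omega) (by omega), hWc (by omega) (by omega), hp0, hp1]
    exact Nat.div_le_div_right hdiag
  · have hkey : ∀ j, 2 ≤ j → j < c → keyOf w j =
        16 * wt G (p j) v₀ + 4 * wt G (p j) v₁ + wt G (p j) (p j) / 2 := fun j hj hjc => by
      rw [keyOf, hwd, ← hWo j 0 (by omega), ← hWo j 1 (by omega), hWc hjc (by omega),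
        hWc hjc (by omega), hWc hjc hjc, hp0, hp1]
    rw [hkey _ (by omega) hic, hkey _ hi (by omega)]
    obtain ⟨i, rfl⟩ := Nat.exists_eq_add_of_le' hi
    rw [hpK hic, hpK (by omega : i + 2 < c)]
    have hLl : L.length + 2 = c := by rw [← hKc]; simp [hK]
    exact List.pairwise_iff_getElem.1 hLs i (i + 1) (by omega) (by omega) (by omega)
  · rw [← hWd, hWc hi hi]
  · rw [← hWo i j hij, hWc hi hj]

end Index

/-! ### Recognising the obstructions from their cores -/

/-- A graph on `n` vertices given by its edges, with a description of its core: the matrix of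
weights of the core, the position of every vertex relative to the core, and some vertex sets
which span more edges than vertices. The label `(j, j, 0)` belongs to the core vertex `j` and
`(j, k, l + 1)` to the vertex number `l` of degree two attached to the core vertices `j, k`. -/
structure Model where
  n : ℕ
  edges : List (ℕ × ℕ)
  weights : List (ℕ × List ℕ)
  labels : List (ℕ × ℕ × ℕ)
  dense : List (List ℕ)

/-- The graph described by a model. -/
def Model.graph (m : Model) : SimpleGraph (Fin m.n) := mkGraph m.n m.edges

/-- The number of vertices of degree two attached to the core vertices `j` and `k`. -/
def thinBound (M : List (ℕ × List ℕ)) (j k : ℕ) : ℕ :=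
  bif Nat.beq j k then 2 * matEntry M j k else matEntry M j k - 1

def validLabel (M : List (ℕ × List ℕ)) (a : ℕ × ℕ × ℕ) : Bool :=
  Nat.blt a.1 M.length && Nat.ble a.2.1 a.1 &&
    bif Nat.beq a.2.2 0 then Nat.beq a.2.1 a.1 else Nat.ble a.2.2 (thinBound M a.1 a.2.1)

/-- Two labels which belong to adjacent vertices. -/
def labelAdj (M : List (ℕ × List ℕ)) (a b : ℕ × ℕ × ℕ) : Bool :=
  bif Nat.beq a.2.2 0 then
    bif Nat.beq b.2.2 0 then Nat.blt b.1 a.1 && Nat.blt 0 (matEntry M a.1 b.1)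
    else Nat.beq a.1 b.1 || Nat.beq a.1 b.2.1
  else Nat.beq a.1 a.2.1 && Nat.beq b.1 a.1 && Nat.beq b.2.1 a.1 &&
    Nat.beq b.2.2 (a.2.2 + 1) && Nat.beq (a.2.2 % 2) 1

def edgeAdj (E : List (ℕ × ℕ)) (a b : ℕ) : Bool :=
  !Nat.beq a b && E.any fun e => Nat.beq e.1 a && Nat.beq e.2 b || Nat.beq e.1 b && Nat.beq e.2 a

def edgeCount (E : List (ℕ × ℕ)) (L : List ℕ) : ℕ :=
  (L.map fun a => (L.map fun b => bif edgeAdj E a b then 1 else 0).sum).sum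

def distinct {α : Type} (eq : α → α → Bool) : List α → Bool
  | [] => true
  | a :: as => as.all (fun b => !eq a b) && distinct eq as

def labelBeq (a b : ℕ × ℕ × ℕ) : Bool :=
  Nat.beq a.1 b.1 && Nat.beq a.2.1 b.2.1 && Nat.beq a.2.2 b.2.2

def Model.label (m : Model) (v : ℕ) : ℕ × ℕ × ℕ := m.labels.getD v (0, 0, 0)

def Model.checkLabels (m : Model) : Bool :=
  Nat.beq m.labels.length m.n && m.labels.all (validLabel m.weights) &&
    distinct labelBeq m.labels && m.edges.all fun e =>
      Nat.blt e.1 m.n && Nat.blt e.2 m.n &&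
        (labelAdj m.weights (m.label e.1) (m.label e.2) ||
          labelAdj m.weights (m.label e.2) (m.label e.1))

def Model.checkDense (m : Model) : Bool :=
  Nat.blt 0 m.n && (List.range m.n).all fun v =>
    ((List.range m.n).filter (fun u => !Nat.beq u v) :: m.dense).any fun L =>
      !L.any (Nat.beq v) && L.all (fun u => Nat.blt u m.n) && distinct Nat.beq L &&
        Nat.blt (2 * L.length) (edgeCount m.edges L)

/-- Models of the obstructions. -/
def models : List Model :=
  [⟨8, [(0, 1), (0, 2), (0, 3), (1, 2), (1, 3), (4, 5), (4, 6), (4, 7), (5, 6), (5, 7)], [(0, [3,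
     0, 0]), (0, [0, 0]), (0, [3]), (0, [])], [(0, 0, 0), (1, 1, 0), (1, 0, 1), (1, 0, 2), (2, 2, 0),
     (3, 3, 0), (3, 2, 1), (3, 2, 2)], [[0, 1, 2, 3], [4, 5, 6, 7]]⟩,
   ⟨10, [(0, 1), (0, 2), (1, 2), (0, 3), (0, 4), (3, 4), (5, 6), (5, 7), (6, 7), (5, 8), (5, 9),
     (8, 9)], [(2, [0]), (2, [])], [(0, 0, 0), (0, 0, 1), (0, 0, 2), (0, 0, 3), (0, 0, 4), (1, 1, 0),
     (1, 1, 1), (1, 1, 2), (1, 1, 3), (1, 1, 4)], [[0, 1, 2, 3, 4], [5, 6, 7, 8, 9]]⟩,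
   ⟨9, [(0, 1), (0, 2), (0, 3), (1, 2), (1, 3), (4, 5), (4, 6), (5, 6), (4, 7), (4, 8), (7, 8)],
     [(2, [0, 0]), (0, [3]), (0, [])], [(0, 0, 0), (1, 1, 0), (1, 0, 1), (1, 0, 2), (2, 2, 0), (2, 2,
     1), (2, 2, 2), (2, 2, 3), (2, 2, 4)], [[0, 1, 2, 3], [4, 5, 6, 7, 8]]⟩,
   ⟨8, [(0, 1), (0, 2), (1, 2), (2, 3), (2, 4), (3, 4), (3, 5), (4, 5), (5, 6), (5, 7), (6, 7)],
     [(1, [1, 1, 0]), (0, [1, 1]), (0, [1]), (1, [])], [(0, 0, 1), (0, 0, 2), (0, 0, 0), (1, 1, 0),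
     (2, 2, 0), (3, 3, 0), (3, 3, 1), (3, 3, 2)], [[0, 1, 2, 3, 4], [3, 4, 5, 6, 7]]⟩,
   ⟨8, [(0, 1), (0, 2), (1, 2), (2, 3), (2, 4), (3, 4), (3, 5), (4, 6), (5, 6), (5, 7), (6, 7)],
     [(0, [2, 1, 0, 0]), (0, [0, 1, 0]), (0, [1, 1]), (0, [1]), (1, [])], [(0, 0, 1), (0, 0, 2), (0,
     0, 0), (1, 1, 0), (2, 2, 0), (3, 3, 0), (4, 4, 0), (4, 3, 1)], [[3, 4, 5, 6, 7]]⟩,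
   ⟨8, [(0, 1), (0, 2), (1, 2), (2, 3), (2, 4), (3, 4), (3, 5), (4, 5), (3, 6), (5, 6), (4, 7), (5,
     7)], [(0, [2, 2, 0]), (0, [1, 1]), (0, [1]), (1, [])], [(0, 0, 1), (0, 0, 2), (0, 0, 0), (1, 1,
     0), (2, 2, 0), (3, 3, 0), (3, 1, 1), (3, 2, 1)], []⟩,
   ⟨7, [(0, 1), (0, 6), (1, 6), (2, 3), (2, 4), (2, 5), (3, 4), (3, 5), (4, 6), (5, 6)], [(1, [1,
     1, 0, 0]), (0, [0, 1, 1]), (0, [1, 1]), (0, [1]), (0, [])], [(4, 4, 1), (4, 4, 2), (0, 0, 0),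
     (1, 1, 0), (2, 2, 0), (3, 3, 0), (4, 4, 0)], [[2, 3, 4, 5]]⟩,
   ⟨7, [(0, 1), (0, 2), (1, 2), (2, 3), (2, 4), (2, 5), (3, 4), (3, 5), (4, 5), (4, 6), (5, 6)],
     [(0, [2, 1, 1]), (0, [1, 1]), (0, [1]), (1, [])], [(0, 0, 1), (0, 0, 2), (0, 0, 0), (1, 1, 0),
     (2, 2, 0), (3, 3, 0), (3, 2, 1)], [[3, 4, 5, 6]]⟩,
   ⟨9, [(0, 1), (0, 2), (1, 2), (2, 3), (2, 4), (3, 4), (3, 5), (4, 5), (2, 6), (4, 6), (2, 7), (3,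
     7), (3, 8), (4, 8)], [(0, [3, 2]), (0, [2]), (1, [])], [(0, 0, 1), (0, 0, 2), (0, 0, 0), (1, 1,
     0), (2, 2, 0), (2, 1, 1), (2, 0, 1), (1, 0, 1), (2, 1, 2)], [[3, 4, 5, 6, 7, 8]]⟩,
   ⟨9, [(0, 1), (1, 2), (2, 3), (3, 0), (0, 4), (1, 4), (1, 5), (2, 5), (2, 6), (3, 6), (0, 7), (0,
     8), (7, 8)], [(0, [2, 0, 1]), (0, [2, 0]), (0, [2]), (1, [])], [(0, 0, 0), (1, 1, 0), (2, 2, 0),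
     (3, 3, 0), (1, 0, 1), (2, 1, 1), (3, 2, 1), (0, 0, 1), (0, 0, 2)], [[1, 2, 3, 4, 5, 6]]⟩,
   ⟨9, [(0, 1), (0, 2), (1, 2), (3, 4), (3, 5), (4, 5), (6, 7), (6, 8), (7, 8), (2, 3), (1, 8), (4,
     8)], [(1, [1, 0, 0, 1]), (0, [2, 0, 0]), (0, [1, 0]), (0, [2]), (0, [])], [(1, 0, 1), (0, 0, 0),
     (1, 1, 0), (2, 2, 0), (3, 3, 0), (3, 2, 1), (4, 4, 1), (4, 4, 2), (4, 4, 0)], [[0, 1, 2, 3, 4,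
     5]]⟩,
   ⟨9, [(0, 1), (0, 2), (1, 2), (3, 4), (3, 5), (4, 5), (6, 7), (6, 8), (7, 8), (2, 3), (2, 7), (3,
     6)], [(0, [2, 0, 1]), (0, [1, 0]), (1, [1]), (1, [])], [(0, 0, 1), (0, 0, 2), (0, 0, 0), (1, 1,
     0), (1, 1, 1), (1, 1, 2), (2, 2, 0), (3, 3, 0), (3, 2, 1)], [[0, 1, 2, 6, 7, 8], [3, 4, 5, 6, 7,
     8]]⟩,
   ⟨9, [(0, 1), (0, 2), (1, 2), (3, 4), (3, 5), (4, 5), (6, 7), (6, 8), (7, 8), (2, 3), (2, 8), (3,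
     8)], [(1, [1, 1]), (1, [1]), (1, [])], [(0, 0, 1), (0, 0, 2), (0, 0, 0), (1, 1, 0), (1, 1, 1),
     (1, 1, 2), (2, 2, 1), (2, 2, 2), (2, 2, 0)], [[0, 1, 2, 3, 4, 5], [0, 1, 2, 6, 7, 8], [3, 4, 5,
     6, 7, 8]]⟩,
   ⟨8, [(0, 1), (0, 2), (1, 2), (1, 4), (2, 3), (2, 4), (3, 4), (3, 5), (4, 5), (1, 6), (1, 7), (6,
     7)], [(0, [2, 1, 1]), (0, [1, 0]), (0, [2]), (1, [])], [(1, 0, 1), (0, 0, 0), (1, 1, 0), (2, 2,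
     0), (3, 3, 0), (3, 2, 1), (0, 0, 1), (0, 0, 2)], [[0, 2, 3, 4, 5]]⟩,
   ⟨9, [(0, 1), (0, 2), (1, 2), (2, 3), (2, 4), (3, 4), (4, 5), (4, 6), (5, 6), (6, 7), (6, 8), (7,
     8), (2, 6)], [(1, [2, 1]), (0, [2]), (1, [])], [(0, 0, 1), (0, 0, 2), (0, 0, 0), (1, 0, 1), (1,
     1, 0), (2, 1, 1), (2, 2, 0), (2, 2, 1), (2, 2, 2)], [[0, 1, 2, 3, 4, 5], [3, 4, 5, 6, 7, 8]]⟩,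
   ⟨6, [(0, 2), (0, 3), (0, 4), (0, 5), (1, 2), (1, 3), (1, 4), (1, 5), (2, 3), (4, 5)], [(0, [1,
     0, 0, 1, 1]), (0, [0, 0, 1, 1]), (0, [1, 1, 1]), (0, [1, 1]), (0, [0]), (0, [])], [(0, 0, 0),
     (1, 1, 0), (2, 2, 0), (3, 3, 0), (4, 4, 0), (5, 5, 0)], []⟩,
   ⟨6, [(0, 1), (1, 3), (3, 2), (2, 0), (4, 0), (4, 1), (4, 2), (4, 3), (5, 0), (5, 1)], [(0, [1,
     1, 1, 1]), (0, [1, 1, 0]), (0, [0, 1]), (0, [2]), (0, [])], [(0, 0, 0), (1, 1, 0), (2, 2, 0),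
     (3, 3, 0), (4, 4, 0), (1, 0, 1)], []⟩,
   ⟨8, [(0, 1), (1, 2), (2, 3), (3, 0), (4, 0), (4, 1), (5, 1), (5, 2), (6, 2), (6, 3), (7, 3), (7,
     0)], [(0, [2, 0, 2]), (0, [2, 0]), (0, [2]), (0, [])], [(0, 0, 0), (1, 1, 0), (2, 2, 0), (3, 3,
     0), (1, 0, 1), (2, 1, 1), (3, 2, 1), (3, 0, 1)], []⟩,
   ⟨7, [(0, 2), (0, 3), (1, 2), (1, 3), (2, 3), (0, 4), (4, 1), (5, 0), (5, 4), (6, 4), (6, 1)],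
     [(0, [0, 0, 2, 2]), (0, [1, 1, 1]), (0, [1, 1]), (0, [0]), (0, [])], [(0, 0, 0), (1, 1, 0), (2,
     2, 0), (3, 3, 0), (4, 4, 0), (4, 0, 1), (4, 1, 1)], []⟩,
   ⟨6, [(1, 2), (1, 4), (1, 5), (2, 4), (2, 5), (4, 5), (0, 1), (0, 4), (2, 3), (3, 5)], [(0, [1,
     2, 1]), (0, [1, 2]), (0, [1]), (0, [])], [(2, 0, 1), (0, 0, 0), (1, 1, 0), (3, 1, 1), (2, 2, 0),
     (3, 3, 0)], []⟩,
   ⟨7, [(0, 1), (0, 3), (0, 4), (1, 3), (1, 4), (3, 5), (4, 5), (1, 2), (2, 4), (3, 6), (5, 6)],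
     [(0, [1, 2, 0, 0]), (0, [0, 2, 1]), (0, [1, 1]), (0, [1]), (0, [])], [(0, 0, 0), (1, 1, 0), (3,
     1, 1), (2, 2, 0), (3, 3, 0), (4, 4, 0), (4, 2, 1)], []⟩,
   ⟨8, [(0, 1), (0, 3), (1, 4), (3, 4), (1, 2), (2, 4), (7, 0), (7, 3), (5, 7), (5, 0), (6, 7), (6,
     3)], [(0, [0, 2, 0, 2]), (0, [1, 2, 0]), (0, [0, 1]), (0, [1]), (0, [])], [(0, 0, 0), (1, 1, 0),
     (3, 1, 1), (2, 2, 0), (3, 3, 0), (4, 0, 1), (4, 2, 1), (4, 4, 0)], []⟩,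
   ⟨7, [(2, 3), (2, 4), (2, 6), (3, 4), (3, 6), (4, 6), (5, 3), (5, 4), (0, 2), (0, 3), (1, 2), (1,
     4)], [(0, [1, 1, 1]), (0, [2, 2]), (0, [2]), (0, [])], [(1, 0, 1), (2, 0, 1), (0, 0, 0), (1, 1,
     0), (2, 2, 0), (2, 1, 1), (3, 3, 0)], []⟩,
   ⟨7, [(0, 1), (0, 2), (1, 2), (1, 3), (2, 4), (3, 5), (3, 6), (4, 5), (4, 6), (5, 6)], [(0, [1,
     1, 1, 0, 0]), (0, [1, 1, 0, 0]), (0, [0, 1, 0]), (0, [0, 1]), (0, [2]), (0, [])], [(1, 0, 1),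
     (0, 0, 0), (1, 1, 0), (2, 2, 0), (3, 3, 0), (4, 4, 0), (5, 5, 0)], []⟩,
   ⟨8, [(0, 1), (0, 3), (1, 3), (1, 2), (1, 5), (2, 5), (1, 7), (2, 7), (3, 4), (4, 5), (3, 5), (3,
     6), (5, 6)], [(0, [3, 1, 1]), (0, [0, 2]), (0, [2]), (0, [])], [(2, 0, 1), (0, 0, 0), (1, 1, 0),
     (2, 2, 0), (3, 2, 1), (3, 3, 0), (3, 2, 2), (1, 0, 1)], []⟩,
   ⟨9, [(2, 3), (2, 4), (3, 4), (5, 3), (5, 4), (8, 3), (8, 4), (0, 2), (0, 3), (7, 2), (7, 3), (1,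
     2), (1, 4), (6, 2), (6, 4)], [(0, [3, 3]), (0, [3]), (0, [])], [(1, 0, 1), (2, 0, 1), (0, 0, 0),
     (1, 1, 0), (2, 2, 0), (2, 1, 1), (2, 0, 2), (1, 0, 2), (2, 1, 2)], []⟩,
   ⟨8, [(0, 2), (1, 2), (0, 3), (2, 3), (1, 6), (2, 6), (3, 4), (6, 7), (4, 5), (5, 7), (3, 7), (4,
     7)], [(0, [1, 2, 1, 0]), (0, [0, 0, 2]), (0, [1, 0]), (0, [2]), (0, [])], [(1, 0, 1), (3, 0, 1),
     (0, 0, 0), (1, 1, 0), (2, 2, 0), (4, 2, 1), (3, 3, 0), (4, 4, 0)], []⟩,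
   ⟨7, [(0, 1), (0, 2), (1, 2), (1, 3), (1, 5), (3, 5), (3, 4), (3, 6), (4, 6), (2, 5), (5, 6)],
     [(0, [1, 2, 0, 0]), (0, [1, 1, 1]), (0, [0, 1]), (0, [2]), (0, [])], [(1, 0, 1), (0, 0, 0), (1,
     1, 0), (2, 2, 0), (4, 2, 1), (3, 3, 0), (4, 4, 0)], []⟩,
   ⟨9, [(0, 1), (0, 2), (1, 2), (3, 4), (3, 5), (4, 5), (6, 7), (6, 8), (7, 8), (2, 3), (1, 7), (4,
     6)], [(0, [2, 0, 0, 0, 1]), (0, [1, 0, 0, 0]), (0, [2, 0, 0]), (0, [1, 0]), (0, [2]), (0, [])],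
     [(1, 0, 1), (0, 0, 0), (1, 1, 0), (2, 2, 0), (3, 3, 0), (3, 2, 1), (4, 4, 0), (5, 5, 0), (5, 4,
     1)], []⟩,
   ⟨8, [(0, 1), (0, 2), (1, 2), (3, 4), (3, 5), (4, 5), (6, 7), (1, 6), (4, 6), (0, 7), (5, 7)],
     [(0, [1, 1, 0, 0, 1]), (0, [0, 1, 1, 0]), (0, [2, 0, 0]), (0, [0, 0]), (0, [2]), (0, [])], [(0,
     0, 0), (1, 1, 0), (1, 0, 1), (3, 2, 1), (2, 2, 0), (3, 3, 0), (4, 4, 0), (5, 5, 0)], []⟩,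
   ⟨6, [(0, 1), (0, 2), (1, 2), (3, 4), (3, 5), (4, 5), (0, 3), (1, 4), (2, 5)], [(0, [1, 1, 1, 0,
     0]), (0, [1, 0, 1, 0]), (0, [0, 0, 1]), (0, [1, 1]), (0, [1]), (0, [])], [(0, 0, 0), (1, 1, 0),
     (2, 2, 0), (3, 3, 0), (4, 4, 0), (5, 5, 0)], []⟩,
   ⟨6, [(0, 3), (0, 4), (0, 5), (1, 3), (1, 4), (1, 5), (2, 3), (2, 4), (2, 5)], [(0, [0, 0, 1, 1,
     1]), (0, [0, 1, 1, 1]), (0, [1, 1, 1]), (0, [0, 0]), (0, [0]), (0, [])], [(0, 0, 0), (1, 1, 0),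
     (2, 2, 0), (3, 3, 0), (4, 4, 0), (5, 5, 0)], []⟩,
   ⟨5, [(0, 1), (0, 2), (0, 3), (0, 4), (1, 2), (1, 3), (1, 4), (2, 3), (2, 4)], [(0, [0, 1, 1,
     1]), (0, [1, 1, 1]), (0, [1, 1]), (0, [1]), (0, [])], [(0, 0, 0), (1, 1, 0), (2, 2, 0), (3, 3,
     0), (4, 4, 0)], []⟩]

lemma models_check : (models.all fun m => m.checkLabels && m.checkDense) = true := by
  decide +kernel

lemma models_graph : models.map (fun m => (⟨m.n, m.graph⟩ : (n : ℕ) × SimpleGraph (Fin n))) =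
    OList := rfl

/-! ### Obstructions contain models -/

lemma nodup_of_distinct {α : Type} {eq : α → α → Bool} (heq : ∀ a, eq a a = true) {L : List α}
    (h : distinct eq L = true) : L.Nodup := by
  induction L with
  | nil => exact List.nodup_nil
  | cons a as ih =>
    rw [distinct, Bool.and_eq_true, List.all_eq_true] at h
    refine List.nodup_cons.2 ⟨fun ha => ?_, ih h.2⟩
    have := h.1 a ha
    simp [heq] at this

lemma edgeAdj_iff {n : ℕ} {E : List (ℕ × ℕ)} {a b : Fin n} :
    edgeAdj E a b = true ↔ (mkGraph n E).Adj a b := by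
  simp only [edgeAdj, mkGraph, fromRel_adj, Bool.and_eq_true, List.any_eq_true, Bool.or_eq_true,
    beq_eq_decide, decide_eq_true_eq, decide_eq_false_iff_not, Bool.not_eq_true', ne_eq,
    ← Fin.val_inj]
  constructor
  · rintro ⟨h1, ⟨x, y⟩, hm, ⟨rfl, rfl⟩ | ⟨rfl, rfl⟩⟩
    · exact ⟨h1, .inl hm⟩
    · exact ⟨h1, .inr hm⟩
  · rintro ⟨h1, hm⟩
    refine ⟨h1, ?_⟩
    · rcases hm with hm | hm
      · exact ⟨_, hm, .inl ⟨rfl, rfl⟩⟩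
      · exact ⟨_, hm, .inr ⟨rfl, rfl⟩⟩

lemma dsum_mkGraph {n : ℕ} (E : List (ℕ × ℕ)) {L : List ℕ} (hL : ∀ u ∈ L, u < n) (hn : L.Nodup) :
    dsum (mkGraph n E) {v | v.1 ∈ L} = edgeCount E L ∧ #{v : Fin n | v.1 ∈ L} = L.length := by
  classical
  have hmap : (univ.filter fun v : Fin n => v.1 ∈ L).map Fin.valEmbedding = L.toFinset := by
    ext u
    simp only [mem_map, mem_filter, mem_univ, true_and, Fin.valEmbedding_apply, List.mem_toFinset]
    exact ⟨by rintro ⟨v, hv, rfl⟩; exact hv, fun hu => ⟨⟨u, hL u hu⟩, hu, rfl⟩⟩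
  constructor
  · have hsum : ∀ f : ℕ → ℕ, ∑ v : Fin n with v.1 ∈ L, f v = (L.map f).sum := fun f => by
      rw [← List.sum_toFinset f hn, ← hmap, sum_map]
      rfl
    unfold edgeCount dsum
    rw [← hsum]
    refine sum_congr rfl fun a _ => ?_
    rw [← hsum]
    refine sum_congr rfl fun b _ => ?_
    rw [← if_congr (edgeAdj_iff (E := E) (a := a) (b := b)) rfl rfl, Bool.cond_eq_ite]
  · rw [← card_map Fin.valEmbedding, hmap, List.toFinset_card_of_nodup hn]

lemma Model.not_apexPseudoforest {m : Model} (h : m.checkDense = true) :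
    ¬ ApexPseudoforest m.graph := by
  simp only [Model.checkDense, Bool.and_eq_true, List.all_eq_true, List.mem_range,
    List.any_eq_true, Nat.blt_eq] at h
  intro hG
  have : Nonempty (Fin m.n) := ⟨⟨0, h.1⟩⟩
  obtain ⟨v, hv⟩ := ApexPseudoforest.exists_le hG
  obtain ⟨L, -, ⟨⟨h1, h2⟩, h3⟩, h4⟩ := h.2 v v.2
  have hn := nodup_of_distinct (fun a => by simp) h3
  obtain ⟨h5, h6⟩ := dsum_mkGraph m.edges h2 hn
  have h7 := hv {v | v.1 ∈ L} (fun hvL => by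
    rw [mem_filter] at hvL
    rw [Bool.not_eq_true', ← Bool.not_eq_true] at h1
    exact h1 (List.any_eq_true.2 ⟨v, hvL.2, by simp⟩))
  rw [Model.graph, h5, h6] at h7
  omega

section Realise

variable {V : Type} [Fintype V] {G : SimpleGraph V}

lemma Obs.exists_thin_enumeration (h : ObsApexPseudoforest G) {M : List (ℕ × List ℕ)} {p : ℕ → V}
    (hinj : ∀ i < M.length, ∀ j < M.length, p i = p j → i = j)
    (hd : ∀ i < M.length, wt G (p i) (p i) = 2 * matEntry M i i)
    (ho : ∀ i < M.length, ∀ j < i, wt G (p i) (p j) = matEntry M i j) {j k : ℕ}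
    (hj : j < M.length) (hk : k ≤ j) :
    ∃ g : ℕ → V, (∀ l < thinBound M j k, g l ∈ thinAt G (p j) (p k)) ∧
      (∀ l < thinBound M j k, ∀ l' < thinBound M j k, g l = g l' → l = l') ∧
      (j = k → ∀ l < matEntry M j j, G.Adj (g (2 * l)) (g (2 * l + 1))) := by
  rcases hk.lt_or_eq with hk | rfl
  · have hne : p j ≠ p k := fun he => hk.ne' (hinj j hj k (hk.trans hj) he)
    have hB : thinBound M j k = matEntry M j k - 1 := by
      rw [thinBound, beq_eq_decide, decide_eq_false hk.ne']; rfl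
    have hcard : thinBound M j k ≤ #(thinAt G (p j) (p k)) := by
      have h1 := ho j hj k hk
      unfold wt at h1
      rw [hB]
      split_ifs at h1 <;> omega
    have := Obs.nonempty h
    refine ⟨fun l => (thinAt G (p j) (p k)).toList.getD l (Classical.arbitrary V),
      fun l hl => ?_, fun l hl l' hl' he => ?_, fun he => absurd he hk.ne'⟩
    · dsimp only
      rw [List.getD_eq_getElem _ _ (by rw [length_toList]; omega), ← mem_toList]
      exact List.getElem_mem _
    · dsimp only at he
      rw [List.getD_eq_getElem _ _ (by rw [length_toList]; omega),
        List.getD_eq_getElem _ _ (by rw [length_toList]; omega)] at he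
      exact ((nodup_toList _).getElem_inj_iff).1 he
  · obtain ⟨n, g, hn, h1, h2, h3⟩ := Obs.thinAt_self h (p k)
    have hB : thinBound M k k = 2 * matEntry M k k := by
      rw [thinBound, beq_eq_decide, decide_eq_true rfl]; rfl
    rw [hd k hj] at hn
    obtain rfl : matEntry M k k = n := by omega
    rw [hB]
    exact ⟨g, h1, h2, fun _ => h3⟩

lemma Obs.exists_realisation (h : ObsApexPseudoforest G) {M : List (ℕ × List ℕ)} {p : ℕ → V}
    (hC : ∀ i < M.length, p i ∈ core G)
    (hinj : ∀ i < M.length, ∀ j < M.length, p i = p j → i = j)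
    (hd : ∀ i < M.length, wt G (p i) (p i) = 2 * matEntry M i i)
    (ho : ∀ i < M.length, ∀ j < i, wt G (p i) (p j) = matEntry M i j) :
    ∃ φ : ℕ × ℕ × ℕ → V, (∀ a b, validLabel M a = true → validLabel M b = true → φ a = φ b → a = b) ∧
      ∀ a b, validLabel M a = true → validLabel M b = true → labelAdj M a b = true →
        G.Adj (φ a) (φ b) := by
  classical
  have := Obs.nonempty h
  choose! g hg hginj hgadj using fun j k (hj : j < M.length) (hk : k ≤ j) =>
    Obs.exists_thin_enumeration h hinj hd ho hj hk
  have hvalid : ∀ {j k m}, validLabel M (j, k, m) = true → j < M.length ∧ k ≤ j ∧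
      (m = 0 → k = j) ∧ (m ≠ 0 → m - 1 < thinBound M j k) := by
    intro j k m hv
    simp only [validLabel, Bool.and_eq_true, Nat.blt_eq, Nat.ble_eq, beq_eq_decide,
      Bool.cond_decide] at hv
    obtain ⟨⟨h1, h2⟩, h3⟩ := hv
    refine ⟨h1, h2, fun hm => ?_, fun hm => ?_⟩
    · rw [if_pos hm] at h3; simpa using h3
    · rw [if_neg hm, Nat.ble_eq] at h3; omega
  refine ⟨fun a => if a.2.2 = 0 then p a.1 else g a.1 a.2.1 (a.2.2 - 1), ?_, ?_⟩
  · rintro ⟨j, k, m⟩ ⟨j', k', m'⟩ ha hb he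
    obtain ⟨h1, h2, h3, h4⟩ := hvalid ha
    obtain ⟨h1', h2', h3', h4'⟩ := hvalid hb
    dsimp only at he
    split_ifs at he with h5 h6 h6
    · have := hinj j h1 j' h1' he
      rw [h3 h5, h3' h6, this, h5, h6]
    · have h7 := (mem_thinAt.1 (hg j' k' h1' h2' _ (h4' h6))).1
      rw [← he] at h7
      exact absurd (hC j h1) (thin_notMem_core h7)
    · have h7 := (mem_thinAt.1 (hg j k h1 h2 _ (h4 h5))).1
      rw [he] at h7
      exact absurd (hC j' h1') (thin_notMem_core h7)
    · have h7 := (mem_thinAt.1 (hg j k h1 h2 _ (h4 h5))).2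
      have h7' := (mem_thinAt.1 (hg j' k' h1' h2' _ (h4' h6))).2
      rw [← he, h7] at h7'
      have e1 := congrArg (p j ∈ ·) h7'
      have e2 := congrArg (p k ∈ ·) h7'
      have e3 := congrArg (p j' ∈ ·) h7'
      have e4 := congrArg (p k' ∈ ·) h7'
      have hpi : ∀ {a b}, a < M.length → b < M.length → (p a = p b ↔ a = b) := fun ha hb =>
        ⟨hinj _ ha _ hb, fun h => h ▸ rfl⟩
      have hk := h2.trans_lt h1
      have hk' := h2'.trans_lt h1'
      simp only [Finset.mem_insert, Finset.mem_singleton, hpi h1 h1', hpi h1 hk', hpi hk h1',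
        hpi hk hk', hpi h1 hk, hpi hk h1, hpi h1' h1, hpi h1' hk, hpi hk' h1, hpi hk' hk,
        hpi h1' hk', hpi hk' h1', true_or, or_true, eq_iff_iff, true_iff, iff_true] at e1 e2 e3 e4
      obtain rfl : j = j' := by omega
      obtain rfl : k = k' := by omega
      have := hginj j k h1 h2 _ (h4 h5) _ (h4' h6) he
      obtain rfl : m = m' := by omega
      rfl
  · rintro ⟨j, k, m⟩ ⟨j', k', m'⟩ ha hb hl
    obtain ⟨h1, h2, h3, h4⟩ := hvalid ha
    obtain ⟨h1', h2', h3', h4'⟩ := hvalid hb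
    dsimp only
    simp only [labelAdj, beq_eq_decide, Bool.cond_decide] at hl
    split_ifs at hl ⊢ with h5 h6 h6
    · rw [Bool.and_eq_true, Nat.blt_eq, Nat.blt_eq] at hl
      refine Obs.adj_of_wt h (fun he => hl.1.ne' (hinj j h1 j' h1' he)) ?_
      rw [ho j h1 j' hl.1]
      exact hl.2
    · have h7 := (mem_thinAt.1 (hg j' k' h1' h2' _ (h4' h6))).2
      have h8 : p j ∈ feet G (g j' k' (m' - 1)) := by
        rw [h7, Finset.mem_insert, Finset.mem_singleton]
        simp only [Bool.or_eq_true, decide_eq_true_eq] at hl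
        rcases hl with rfl | rfl <;> simp
      exact (mem_feet.1 h8).2.symm
    · simp only [Bool.and_eq_true, decide_eq_true_eq] at hl
      omega
    · simp only [Bool.and_eq_true, decide_eq_true_eq] at hl
      obtain ⟨⟨⟨⟨rfl, rfl⟩, rfl⟩, rfl⟩, hl⟩ := hl
      have hB : ∀ i, thinBound M i i = 2 * matEntry M i i := fun i => by
        rw [thinBound, beq_eq_decide, decide_eq_true rfl]; rfl
      have h8 := h4 h5
      rw [hB] at h8
      have := hgadj _ _ h1 h2 rfl (m / 2) (by omega)
      convert this using 2 <;> omega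

theorem Obs.isMinorOf_graph (h : ObsApexPseudoforest G) {m : Model} (hm : m.checkLabels = true)
    {p : ℕ → V} (hC : ∀ i < m.weights.length, p i ∈ core G)
    (hinj : ∀ i < m.weights.length, ∀ j < m.weights.length, p i = p j → i = j)
    (hd : ∀ i < m.weights.length, wt G (p i) (p i) = 2 * matEntry m.weights i i)
    (ho : ∀ i < m.weights.length, ∀ j < i, wt G (p i) (p j) = matEntry m.weights i j) :
    IsMinorOf m.graph G := by
  obtain ⟨φ, hφ, hadj⟩ := Obs.exists_realisation h hC hinj hd ho
  simp only [Model.checkLabels, Bool.and_eq_true, List.all_eq_true, beq_eq_decide,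
    decide_eq_true_eq, Nat.blt_eq, Bool.or_eq_true] at hm
  obtain ⟨⟨⟨hlen, hval⟩, hdis⟩, hE⟩ := hm
  have hnd := nodup_of_distinct (fun a => by simp [labelBeq]) hdis
  have hlab : ∀ v : Fin m.n, m.label v = m.labels[v.1]'(hlen.symm ▸ v.2) := fun v =>
    List.getD_eq_getElem _ _ (hlen.symm ▸ v.2)
  have hv : ∀ v : Fin m.n, validLabel m.weights (m.label v) = true := fun v => by
    rw [hlab]; exact hval _ (List.getElem_mem _)
  refine isMinorOf_of_injective (fun v => φ (m.label v)) (fun u v he => ?_) fun a b hab => ?_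
  · have := hφ _ _ (hv u) (hv v) he
    rw [hlab, hlab, hnd.getElem_inj_iff] at this
    exact Fin.ext this
  · have key : ∀ a b : Fin m.n, (a.1, b.1) ∈ m.edges → G.Adj (φ (m.label a)) (φ (m.label b)) := by
      intro a b hab
      rcases (hE _ hab).2 with h1 | h1
      · exact hadj _ _ (hv a) (hv b) h1
      · exact (hadj _ _ (hv b) (hv a) h1).symm
    obtain ⟨-, hab | hab⟩ := hab
    · exact key a b hab
    · exact (key b a hab).symm

end Realise

lemma start_models {c : ℕ} (h2 : 2 ≤ c) (h6 : c ≤ 6) :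
    start (models.map Model.weights) c = true := by
  interval_cases c <;> decide +kernel

theorem Obs.inO {V : Type} [Fintype V] {G : SimpleGraph V} (h : ObsApexPseudoforest G) :
    InO G := by
  obtain ⟨c, w, p, hw, hC, hinj, hd, ho⟩ := Obs.exists_adm h
  obtain ⟨M, hM, rfl, f, hf, hfinj, hfw⟩ :=
    hw.exists_embedding (start_models hw.two_le hw.le_six)
  obtain ⟨m, hm, rfl⟩ := List.mem_map.1 hM
  have hcheck := List.all_eq_true.1 models_check m hm
  rw [Bool.and_eq_true] at hcheck
  have hminor : IsMinorOf m.graph G := by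
    refine Obs.isMinorOf_graph h hcheck.1 (p := fun i => p (f i)) (fun i hi => hC _ (hf i hi))
      (fun i hi j hj he => hfinj i hi j hj (hinj _ (hf i hi) _ (hf j hj) he)) (fun i hi => ?_)
      fun i hi j hj => ?_
    · rw [hd _ (hf i hi), hfw i hi i le_rfl]
    · have hjc := hj.trans hi
      rw [ho _ (hf i hi) _ (hf j hjc) fun he => hj.ne' (hfinj i hi j hjc he), hfw i hi j hj.le]
  have hnot := Model.not_apexPseudoforest hcheck.2
  have hiso : Nonempty (m.graph ≃g G) := by
    by_contra hcon
    exact hnot (h.2 _ _ hminor (not_nonempty_iff.1 hcon))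
  refine ⟨⟨m.n, m.graph⟩, ?_, hiso.map Iso.symm⟩
  rw [← models_graph]
  exact List.mem_map_of_mem hm

end CoreSearch

/-- Every obstruction for apex-pseudoforests not isomorphic to a member of `O`
is triconnected. -/
theorem obstruction_triconnected {V : Type} [Finite V] (G : SimpleGraph V)
    (h1 : ObsApexPseudoforest G) (h2 : ¬ InO G) : KConnected 3 G := by
  have := Fintype.ofFinite V
  exact absurd (CoreSearch.Obs.inO h1) h2
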